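/- arXiv:2008.09235 — 5 statements merged into one kernel-verified Lean document; each statement's English description precedes it below -/
import Mathlib

section
/- Let p be a positive integer, T₁ > 0, a₁ > 0 and ε ∈ ℝ. Let f : SL(2,ℝ) → ℂ be measurable, square-integrable on compact sets, with f(x n_p) = f(x) and |f(x w)| = |f(x)| for all x ∈ SL(2,ℝ), where w = [[0,1],[−1,0]]. If ε ≥ 0 then ‖f‖²_{−T₁,(1/a₁)⁻,−ε} ≤ ‖f‖²_{T₁,a₁⁺,ε} ≤ (T₁²+1)^{ε/2} ‖f‖²_{−T₁,(√(T₁²+1)/a₁)⁻,−ε}. If ε ≤ 0 then (T₁²+1)^{ε/2} ‖f‖²_{−T₁,(1/a₁)⁻,−ε} ≤ ‖f‖²_{T₁,a₁⁺,ε} ≤ ‖f‖²_{−T₁,(√(T₁²+1)/a₁)⁻,−ε}. All are inequalities in [0,∞]. -/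
open MeasureTheory Real Set
open scoped ENNReal NNReal

noncomputable section

abbrev SL2 := Matrix.SpecialLinearGroup (Fin 2) ℝ

instance : TopologicalSpace SL2 :=
  inferInstanceAs (TopologicalSpace {A : Matrix (Fin 2) (Fin 2) ℝ // A.det = 1})
instance : MeasurableSpace SL2 := borel SL2

def kRot (θ : ℝ) : SL2 :=
  ⟨!![Real.cos θ, -Real.sin θ; Real.sin θ, Real.cos θ], by
    simp [Matrix.det_fin_two_of]
    nlinarith [Real.sin_sq_add_cos_sq θ]⟩

def dMat (a : ℝ) : SL2 :=
  if h : a ≠ 0 then ⟨!![a, 0; 0, a⁻¹], by simp [Matrix.det_fin_two_of, mul_inv_cancel₀ h]⟩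
  else 1

def nMat (t : ℝ) : SL2 := ⟨!![1, t; 0, 1], by simp [Matrix.det_fin_two_of]⟩

/-- The Weyl element `w = [[0,1],[−1,0]]`. -/
def wMat : SL2 := ⟨!![0, 1; -1, 0], by simp [Matrix.det_fin_two_of]⟩

def LocSqInt (f : SL2 → ℂ) : Prop :=
  ∀ K : Set (ℝ × ℝ × ℝ), IsCompact K → K ⊆ {q | 0 < q.2.2} →
    IntegrableOn (fun q : ℝ × ℝ × ℝ => ‖f (kRot q.1 * nMat q.2.1 * dMat q.2.2)‖ ^ 2) K volume

/-- `‖f‖²_{T₁,a₁⁻,ε} = ∫₀^{2π} ∫₀^{a₁} ∫_{I(T₁)} |f(k_θ n_T d_a)|² a^ε dT (da/a) dθ`. -/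
def normMinusSq (f : SL2 → ℂ) (T₁ a₁ ε : ℝ) : ℝ≥0∞ :=
  ∫⁻ θ in Ioc (0:ℝ) (2 * π), ∫⁻ a in Ioc (0:ℝ) a₁,
    (∫⁻ T in uIcc (0:ℝ) T₁,
      (‖f (kRot θ * nMat T * dMat a)‖₊ : ℝ≥0∞) ^ 2 * ENNReal.ofReal (a ^ ε))
      * ENNReal.ofReal a⁻¹

/-- `‖f‖²_{T₁,a₁⁺,ε} = ∫₀^{2π} ∫_{a₁}^∞ ∫_{I(T₁)} |f(k_θ n_T d_a)|² a^ε dT (da/a) dθ`. -/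
def normPlusSq (f : SL2 → ℂ) (T₁ a₁ ε : ℝ) : ℝ≥0∞ :=
  ∫⁻ θ in Ioc (0:ℝ) (2 * π), ∫⁻ a in Ioi a₁,
    (∫⁻ T in uIcc (0:ℝ) T₁,
      (‖f (kRot θ * nMat T * dMat a)‖₊ : ℝ≥0∞) ^ 2 * ENNReal.ofReal (a ^ ε))
      * ENNReal.ofReal a⁻¹

theorem measurable_sl2_of_entries {α : Type*} [MeasurableSpace α] {g : α → SL2}
    (hg : ∀ i j, Measurable fun x => (g x : Matrix (Fin 2) (Fin 2) ℝ) i j) : Measurable g := by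
  have hborel : (borel SL2) = MeasurableSpace.comap
      (fun (x : SL2) i j => (x : Matrix (Fin 2) (Fin 2) ℝ) i j)
      (borel (Fin 2 → Fin 2 → ℝ)) := borel_comap
  have hpi : borel (Fin 2 → Fin 2 → ℝ) = MeasurableSpace.pi :=
    (BorelSpace.measurable_eq (α := Fin 2 → Fin 2 → ℝ)).symm
  change @Measurable α SL2 _ (borel SL2) g
  rw [hborel, hpi]
  exact measurable_comap_iff.2 (measurable_pi_iff.2 fun i => measurable_pi_iff.2 fun j => hg i j)

theorem coe_iwasawa (θ T : ℝ) {a : ℝ} (ha : a ≠ 0) :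
    ((kRot θ * nMat T * dMat a : SL2) : Matrix (Fin 2) (Fin 2) ℝ) =
      !![cos θ * a, (cos θ * T - sin θ) * a⁻¹; sin θ * a, (sin θ * T + cos θ) * a⁻¹] := by
  rw [Matrix.SpecialLinearGroup.coe_mul, Matrix.SpecialLinearGroup.coe_mul]
  simp [kRot, nMat, dMat, ha, sub_eq_add_neg]

theorem dMat_zero : dMat 0 = 1 := by simp [dMat]

theorem dMat_one : dMat 1 = 1 := by
  ext i j
  fin_cases i <;> fin_cases j <;> simp [dMat]

theorem measurable_iwasawa :
    Measurable fun q : ℝ × ℝ × ℝ => kRot q.1 * nMat q.2.1 * dMat q.2.2 := by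
  have hd (a : ℝ) : dMat a = dMat (if a = 0 then 1 else a) := by
    split_ifs with h
    · rw [h, dMat_zero, dMat_one]
    · rfl
  have hne (a : ℝ) : (if a = 0 then 1 else a) ≠ 0 := by split_ifs with h <;> simp [h]
  have hm : Measurable fun q : ℝ × ℝ × ℝ => if q.2.2 = 0 then 1 else q.2.2 :=
    Measurable.ite (measurableSet_eq_fun (by fun_prop) measurable_const) measurable_const
      (by fun_prop)
  refine measurable_sl2_of_entries fun i j => ?_
  have he (q : ℝ × ℝ × ℝ) := congrFun (congrFun (coe_iwasawa q.1 q.2.1 (hne q.2.2)) i) j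
  simp only [← hd] at he
  simp only [he]
  fin_cases i <;> fin_cases j <;> dsimp <;> fun_prop

theorem kRot_add_two_pi (θ : ℝ) : kRot (θ + 2 * π) = kRot θ := by
  unfold kRot
  congr 1
  simp

/-- The Iwasawa decomposition of `k_θ n_T d_a w`. -/
theorem iwasawa_mul_wMat (θ T : ℝ) {a : ℝ} (ha : 0 < a) :
    kRot θ * nMat T * dMat a * wMat =
      kRot (θ + -(arctan T + π / 2)) * nMat (-T) * dMat (√(T ^ 2 + 1) / a) := by
  have hs : 0 < √(T ^ 2 + 1) := Real.sqrt_pos.2 (by positivity)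
  have hsq : √(T ^ 2 + 1) ^ 2 = T ^ 2 + 1 := Real.sq_sqrt (by positivity)
  have hc : cos (-(arctan T + π / 2)) = -T / √(T ^ 2 + 1) := by
    rw [cos_neg, cos_add_pi_div_two, sin_arctan, add_comm 1, neg_div]
  have hsn : sin (-(arctan T + π / 2)) = -1 / √(T ^ 2 + 1) := by
    rw [sin_neg, sin_add_pi_div_two, cos_arctan, add_comm 1, neg_div]
  apply Subtype.ext
  rw [Matrix.SpecialLinearGroup.coe_mul, coe_iwasawa _ _ ha.ne',
    coe_iwasawa _ _ (div_pos hs ha).ne', cos_add, sin_add, hc, hsn]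
  generalize √(T ^ 2 + 1) = s at *
  ext i j
  fin_cases i <;> fin_cases j <;>
    simp [wMat, Matrix.mul_apply, Fin.sum_univ_two] <;> field_simp
  all_goals try ring1
  · linear_combination cos θ * hsq
  · linear_combination sin θ * hsq

theorem Function.Periodic.setLIntegral_comp_add {g : ℝ → ℝ≥0∞} {P : ℝ}
    (hg : Function.Periodic g P) (hP : 0 < P) (t c : ℝ) :
    ∫⁻ x in Ioc t (t + P), g (x + c) = ∫⁻ x in Ioc t (t + P), g x := by
  have hshift : ∫⁻ x in Ioc t (t + P), g (x + c) = ∫⁻ x in Ioc (t + c) (t + c + P), g x := by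
    rw [← (measurePreserving_add_right volume c).setLIntegral_comp_preimage_emb
      (measurableEmbedding_addRight c) g (Ioc (t + c) (t + c + P))]
    congr 2
    ext x
    simp [add_right_comm t c P]
  rw [hshift]
  refine (isAddFundamentalDomain_Ioc hP (t + c)).setLIntegral_eq
    (isAddFundamentalDomain_Ioc hP t) g ?_
  rintro ⟨_, n, rfl⟩ x
  change g (n • P + x) = g x
  rw [add_comm]
  exact hg.zsmul n x

/-- The substitution `a = c / b` for the multiplicative measure `da / a`. -/
theorem lintegral_Ioi_div_eq_lintegral_Ioo (g : ℝ → ℝ≥0∞) {a₁ c : ℝ} (ha₁ : 0 < a₁)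
    (hc : 0 < c) :
    ∫⁻ a in Ioi a₁, g a * ENNReal.ofReal a⁻¹ =
      ∫⁻ b in Ioo 0 (c / a₁), g (c / b) * ENNReal.ofReal b⁻¹ := by
  have himage : (fun b => c / b) '' Ioo 0 (c / a₁) = Ioi a₁ := by
    ext a
    constructor
    · rintro ⟨b, ⟨hb0, hb⟩, rfl⟩
      rw [lt_div_iff₀ ha₁] at hb
      exact (lt_div_iff₀ hb0).2 (by linarith)
    · intro ha
      have ha0 : 0 < a := ha₁.trans ha
      exact ⟨c / a, ⟨by positivity, by gcongr; exact ha⟩, by field_simp⟩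
  have hderiv : ∀ b ∈ Ioo 0 (c / a₁),
      HasDerivWithinAt (fun b => c / b) (-c / b ^ 2) (Ioo 0 (c / a₁)) b := by
    intro b hb
    simpa using ((hasDerivAt_const b c).fun_div (hasDerivAt_id b) hb.1.ne').hasDerivWithinAt
  have hinj : InjOn (fun b => c / b) (Ioo 0 (c / a₁)) := by
    intro x hx y hy hxy
    have := hx.1.ne'
    have := hy.1.ne'
    field_simp at hxy
    exact hxy.symm
  rw [← himage, lintegral_image_eq_lintegral_abs_deriv_mul measurableSet_Ioo hderiv hinj]
  refine setLIntegral_congr_fun measurableSet_Ioo fun b hb => ?_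
  have hb0 := hb.1
  rw [mul_left_comm, ← ENNReal.ofReal_mul (abs_nonneg _), neg_div, abs_neg,
    abs_of_pos (by positivity)]
  congr 2
  field_simp

/-- `T ↦ ∫₀^{2π} ∫₀^A |f(k_θ n_T d_b)|² b^{-ε} (db/b) dθ`. -/
def fiberIntegral (f : SL2 → ℂ) (A ε T : ℝ) : ℝ≥0∞ :=
  ∫⁻ θ in Ioc (0:ℝ) (2 * π), ∫⁻ b in Ioo (0:ℝ) A,
    (‖f (kRot θ * nMat T * dMat b)‖₊ : ℝ≥0∞) ^ 2 * ENNReal.ofReal (b ^ (-ε))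
      * ENNReal.ofReal b⁻¹

theorem lintegral_iwasawa_swap {f : SL2 → ℂ} (hf : Measurable f) (ε : ℝ) (A B C : Set ℝ) :
    ∫⁻ θ in A, ∫⁻ a in B,
      (∫⁻ T in C, (‖f (kRot θ * nMat T * dMat a)‖₊ : ℝ≥0∞) ^ 2 * ENNReal.ofReal (a ^ ε))
        * ENNReal.ofReal a⁻¹ =
    ∫⁻ T in C, ∫⁻ θ in A, ∫⁻ a in B,
      (‖f (kRot θ * nMat T * dMat a)‖₊ : ℝ≥0∞) ^ 2 * ENNReal.ofReal (a ^ ε)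
        * ENNReal.ofReal a⁻¹ := by
  have hm : Measurable fun q : ℝ × ℝ × ℝ =>
      (‖f (kRot q.1 * nMat q.2.1 * dMat q.2.2)‖₊ : ℝ≥0∞) ^ 2 * ENNReal.ofReal (q.2.2 ^ ε)
        * ENNReal.ofReal q.2.2⁻¹ := by
    have := hf.comp measurable_iwasawa
    have hpow : Measurable fun q : ℝ × ℝ × ℝ => q.2.2 ^ ε := by fun_prop
    exact ((this.nnnorm.coe_nnreal_ennreal.pow_const 2).mul hpow.ennreal_ofReal).mul
      (by fun_prop)
  have hinner (θ : ℝ) : ∫⁻ a in B,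
      (∫⁻ T in C, (‖f (kRot θ * nMat T * dMat a)‖₊ : ℝ≥0∞) ^ 2 * ENNReal.ofReal (a ^ ε))
        * ENNReal.ofReal a⁻¹ = ∫⁻ T in C, ∫⁻ a in B,
      (‖f (kRot θ * nMat T * dMat a)‖₊ : ℝ≥0∞) ^ 2 * ENNReal.ofReal (a ^ ε)
        * ENNReal.ofReal a⁻¹ := by
    simp_rw [← lintegral_mul_const' _ _ ENNReal.ofReal_ne_top]
    refine lintegral_lintegral_swap (Measurable.aemeasurable ?_)
    exact hm.comp (f := fun q : ℝ × ℝ => (θ, q.2, q.1)) (by fun_prop)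
  simp_rw [hinner]
  refine lintegral_lintegral_swap (Measurable.aemeasurable ?_)
  refine Measurable.lintegral_prod_right' (f := fun q : (ℝ × ℝ) × ℝ =>
    (‖f (kRot q.1.1 * nMat q.1.2 * dMat q.2)‖₊ : ℝ≥0∞) ^ 2 * ENNReal.ofReal (q.2 ^ ε)
      * ENNReal.ofReal q.2⁻¹) ?_
  exact hm.comp (f := fun q : (ℝ × ℝ) × ℝ => (q.1.1, q.1.2, q.2)) (by fun_prop)

theorem normMinusSq_neg {f : SL2 → ℂ} (hf : Measurable f) {T₁ : ℝ} (hT₁ : 0 < T₁) (A ε : ℝ) :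
    normMinusSq f (-T₁) A (-ε) = ∫⁻ T in Icc (-T₁) 0, fiberIntegral f A ε T := by
  rw [normMinusSq, lintegral_iwasawa_swap hf, uIcc_of_ge (by linarith)]
  simp_rw [fiberIntegral, ← restrict_Ioo_eq_restrict_Ioc (a := (0 : ℝ)) (b := A)]

theorem lintegral_fiber_weyl {f : SL2 → ℂ} (hw : ∀ x : SL2, ‖f (x * wMat)‖ = ‖f x‖)
    {a₁ : ℝ} (ha₁ : 0 < a₁) (ε T : ℝ) :
    ∫⁻ θ in Ioc (0:ℝ) (2 * π), ∫⁻ a in Ioi a₁,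
      (‖f (kRot θ * nMat T * dMat a)‖₊ : ℝ≥0∞) ^ 2 * ENNReal.ofReal (a ^ ε)
        * ENNReal.ofReal a⁻¹ =
    ENNReal.ofReal ((T ^ 2 + 1) ^ (ε / 2)) * fiberIntegral f (√(T ^ 2 + 1) / a₁) ε (-T) := by
  have hs : 0 < √(T ^ 2 + 1) := Real.sqrt_pos.2 (by positivity)
  set g : ℝ → ℝ≥0∞ := fun θ => ∫⁻ b in Ioo (0:ℝ) (√(T ^ 2 + 1) / a₁),
    (‖f (kRot θ * nMat (-T) * dMat b)‖₊ : ℝ≥0∞) ^ 2 * ENNReal.ofReal (b ^ (-ε))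
      * ENNReal.ofReal b⁻¹ with hg
  have hper : Function.Periodic g (2 * π) := fun θ => by simp only [hg, kRot_add_two_pi]
  have hinner (θ : ℝ) : ∫⁻ a in Ioi a₁,
      (‖f (kRot θ * nMat T * dMat a)‖₊ : ℝ≥0∞) ^ 2 * ENNReal.ofReal (a ^ ε)
        * ENNReal.ofReal a⁻¹ =
      ENNReal.ofReal ((T ^ 2 + 1) ^ (ε / 2)) * g (θ + -(arctan T + π / 2)) := by
    rw [lintegral_Ioi_div_eq_lintegral_Ioo _ ha₁ hs, hg,
      ← lintegral_const_mul' _ _ ENNReal.ofReal_ne_top]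
    refine setLIntegral_congr_fun measurableSet_Ioo fun b hb => ?_
    have hb0 := hb.1
    have hnorm : ‖f (kRot θ * nMat T * dMat (√(T ^ 2 + 1) / b))‖₊ =
        ‖f (kRot (θ + -(arctan T + π / 2)) * nMat (-T) * dMat b)‖₊ := by
      have h := hw (kRot θ * nMat T * dMat (√(T ^ 2 + 1) / b))
      rw [iwasawa_mul_wMat _ _ (div_pos hs hb0), div_div_cancel₀ hs.ne'] at h
      exact NNReal.eq h.symm
    have hpow : (√(T ^ 2 + 1) / b) ^ ε = (T ^ 2 + 1) ^ (ε / 2) * b ^ (-ε) := by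
      rw [div_rpow hs.le hb0.le, sqrt_eq_rpow, ← rpow_mul (by positivity), rpow_neg hb0.le,
        div_eq_mul_inv, one_div_mul_eq_div]
    rw [hnorm, hpow, ENNReal.ofReal_mul (by positivity)]
    ring
  simp_rw [hinner]
  rw [lintegral_const_mul' _ _ ENNReal.ofReal_ne_top]
  have := hper.setLIntegral_comp_add (by positivity) 0 (-(arctan T + π / 2))
  rw [zero_add] at this
  rw [this, fiberIntegral]

theorem normPlusSq_eq {f : SL2 → ℂ} (hf : Measurable f)
    (hw : ∀ x : SL2, ‖f (x * wMat)‖ = ‖f x‖) {T₁ a₁ : ℝ} (hT₁ : 0 < T₁) (ha₁ : 0 < a₁) (ε : ℝ) :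
    normPlusSq f T₁ a₁ ε = ∫⁻ T in Icc (-T₁) 0,
      ENNReal.ofReal ((T ^ 2 + 1) ^ (ε / 2)) * fiberIntegral f (√(T ^ 2 + 1) / a₁) ε T := by
  rw [normPlusSq, lintegral_iwasawa_swap hf, uIcc_of_le hT₁.le]
  simp_rw [lintegral_fiber_weyl hw ha₁]
  rw [← (Measure.measurePreserving_neg (volume : Measure ℝ)).setLIntegral_comp_preimage_emb
    (MeasurableEquiv.neg ℝ).measurableEmbedding _ (Icc (-T₁) 0)]
  simp

theorem fiberIntegral_mono (f : SL2 → ℂ) {A B : ℝ} (hAB : A ≤ B) (ε T : ℝ) :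
    fiberIntegral f A ε T ≤ fiberIntegral f B ε T :=
  lintegral_mono fun _ => lintegral_mono_set (Ioo_subset_Ioo_right hAB)

/-- comparison of `‖f‖²_{T₁,a₁⁺,ε}` with the norms
`‖f‖²_{−T₁,(·)⁻,−ε}` via the Weyl element, for `f` right `N_p`-periodic with
`|f(xw)| = |f(x)|`. -/
theorem stmt2 (p : ℕ) (hp : 0 < p) (T₁ : ℝ) (hT₁ : 0 < T₁) (a₁ : ℝ) (ha₁ : 0 < a₁) (ε : ℝ)
    (f : SL2 → ℂ) (hf : Measurable f) (hloc : LocSqInt f)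
    (hper : ∀ x : SL2, f (x * nMat (p : ℝ)) = f x)
    (hw : ∀ x : SL2, ‖f (x * wMat)‖ = ‖f x‖) :
    (0 ≤ ε →
      normMinusSq f (-T₁) (1 / a₁) (-ε) ≤ normPlusSq f T₁ a₁ ε ∧
      normPlusSq f T₁ a₁ ε ≤
        ENNReal.ofReal ((T₁ ^ 2 + 1) ^ (ε / 2)) *
          normMinusSq f (-T₁) (Real.sqrt (T₁ ^ 2 + 1) / a₁) (-ε)) ∧
    (ε ≤ 0 →
      ENNReal.ofReal ((T₁ ^ 2 + 1) ^ (ε / 2)) * normMinusSq f (-T₁) (1 / a₁) (-ε)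
          ≤ normPlusSq f T₁ a₁ ε ∧
      normPlusSq f T₁ a₁ ε ≤ normMinusSq f (-T₁) (Real.sqrt (T₁ ^ 2 + 1) / a₁) (-ε)) := by
  rw [normPlusSq_eq hf hw hT₁ ha₁, normMinusSq_neg hf hT₁, normMinusSq_neg hf hT₁,
    ← lintegral_const_mul' _ _ ENNReal.ofReal_ne_top,
    ← lintegral_const_mul' _ _ ENNReal.ofReal_ne_top]
  have hsq {T : ℝ} (hT : T ∈ Icc (-T₁) 0) : T ^ 2 + 1 ≤ T₁ ^ 2 + 1 := by
    nlinarith [hT.1, hT.2]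
  have hone (T : ℝ) : 1 ≤ T ^ 2 + 1 := by nlinarith [sq_nonneg T]
  have hlower (T : ℝ) : fiberIntegral f (1 / a₁) ε T ≤
      fiberIntegral f (√(T ^ 2 + 1) / a₁) ε T := by
    refine fiberIntegral_mono f ?_ ε T
    gcongr
    exact Real.one_le_sqrt.2 (hone T)
  have hupper {T : ℝ} (hT : T ∈ Icc (-T₁) 0) : fiberIntegral f (√(T ^ 2 + 1) / a₁) ε T ≤
      fiberIntegral f (√(T₁ ^ 2 + 1) / a₁) ε T := by
    refine fiberIntegral_mono f ?_ ε T
    have := hsq hT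
    gcongr
  refine ⟨fun hε => ⟨?_, ?_⟩, fun hε => ⟨?_, ?_⟩⟩ <;>
    refine setLIntegral_mono' measurableSet_Icc fun T hT => ?_
  · rw [← one_mul (fiberIntegral f (1 / a₁) ε T)]
    refine mul_le_mul' ?_ (hlower T)
    exact ENNReal.one_le_ofReal.2 (one_le_rpow (hone T) (by linarith))
  · refine mul_le_mul' (ENNReal.ofReal_le_ofReal ?_) (hupper hT)
    exact rpow_le_rpow (by positivity) (hsq hT) (by linarith)
  · refine mul_le_mul' (ENNReal.ofReal_le_ofReal ?_) (hlower T)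
    exact rpow_le_rpow_of_nonpos (by positivity) (hsq hT) (by linarith)
  · rw [← one_mul (fiberIntegral f (√(T₁ ^ 2 + 1) / a₁) ε T)]
    refine mul_le_mul' ?_ (hupper hT)
    exact ENNReal.ofReal_le_one.2 (rpow_le_one_of_one_le_of_nonpos (hone T) (by linarith))
end
end

section
/- Let p be a positive integer, T₁ > 0 and ε ∈ ℝ. Then there exists a constant c > 0, depending only on T₁, ε and p, such that for every measurable f : SL(2,ℝ) → ℂ that is square-integrable on compact sets and satisfies f(x n_p) = f(x) and |f(x w)| = |f(x)| for all x ∈ SL(2,ℝ): ‖f‖²_{T₁,ε} ≤ c ∫₀^{2π} ∫₀^{√(1+T₁²)} (a^{ε} + a^{−ε}) (∫₀^{p} |f(k_θ d_a n_t)|² dt) da/a dθ, as an inequality in [0,∞]. -/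
open MeasureTheory Real Set
open scoped ENNReal NNReal

noncomputable section

/-- `‖f‖²_{T₁,ε} = ∫₀^{2π} ∫₀^∞ ∫₀^{T₁} |f(k_θ n_T d_a)|² a^ε dT (da/a) dθ`. -/
def normXSq (f : SL2 → ℂ) (T₁ ε : ℝ) : ℝ≥0∞ :=
  ∫⁻ θ in Ioc (0:ℝ) (2 * π), ∫⁻ a in Ioi (0:ℝ),
    (∫⁻ T in Ioc (0:ℝ) T₁,
      (‖f (kRot θ * nMat T * dMat a)‖₊ : ℝ≥0∞) ^ 2 * ENNReal.ofReal (a ^ ε))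
      * ENNReal.ofReal a⁻¹

theorem setLIntegral_Ioc_eq_of_periodic {g : ℝ → ℝ≥0∞} {p : ℝ} (hp : 0 < p)
    (hg : Function.Periodic g p) (s t : ℝ) :
    ∫⁻ x in Ioc s (s + p), g x = ∫⁻ x in Ioc t (t + p), g x := by
  refine (isAddFundamentalDomain_Ioc hp s).setLIntegral_eq (isAddFundamentalDomain_Ioc hp t) g ?_
  rintro ⟨_, n, rfl⟩ x
  change g (n • p + x) = g x
  rw [add_comm]
  exact hg.zsmul n x

theorem setLIntegral_Ioc_comp_add_right_of_periodic {g : ℝ → ℝ≥0∞} {p : ℝ} (hp : 0 < p)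
    (hg : Function.Periodic g p) (s : ℝ) :
    ∫⁻ x in Ioc 0 p, g (x + s) = ∫⁻ x in Ioc 0 p, g x := by
  have h := lintegral_image_eq_lintegral_abs_deriv_mul (s := Ioc 0 p) (f := fun x => x + s)
    (f' := fun _ => 1) measurableSet_Ioc
    (fun x _ => ((hasDerivAt_id x).add_const s).hasDerivWithinAt)
    (add_left_injective s).injOn g
  simp only [Set.image_add_const_Ioc, abs_one, ENNReal.ofReal_one, one_mul] at h
  rw [← h, zero_add, add_comm p s, setLIntegral_Ioc_eq_of_periodic hp hg s 0, zero_add]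

theorem setLIntegral_Ioc_comp_neg_of_periodic {g : ℝ → ℝ≥0∞} {p : ℝ} (hp : 0 < p)
    (hg : Function.Periodic g p) :
    ∫⁻ x in Ioc 0 p, g (-x) = ∫⁻ x in Ioc 0 p, g x := by
  have h := lintegral_image_eq_lintegral_abs_deriv_mul (s := Ioc 0 p) (f := fun x => -x)
    (f' := fun _ => -1) measurableSet_Ioc (fun x _ => (hasDerivAt_neg x).hasDerivWithinAt)
    neg_injective.injOn g
  simp only [Set.image_neg_eq_neg, Set.neg_Ioc, abs_neg, abs_one, ENNReal.ofReal_one, one_mul,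
    neg_zero] at h
  rw [← h, setLIntegral_congr Ico_ae_eq_Ioc]
  have := setLIntegral_Ioc_eq_of_periodic hp hg (-p) 0
  rwa [neg_add_cancel, zero_add] at this

theorem setLIntegral_Ioc_nat_mul_of_periodic {g : ℝ → ℝ≥0∞} {p : ℝ} (hp : 0 < p)
    (hg : Function.Periodic g p) (n : ℕ) :
    ∫⁻ x in Ioc 0 (n * p), g x = n * ∫⁻ x in Ioc 0 p, g x := by
  induction n with
  | zero => simp
  | succ n ih =>
    have hn : 0 ≤ n * p := by positivity
    rw [Nat.cast_succ, add_one_mul, ← Ioc_union_Ioc_eq_Ioc hn (by linarith : n * p ≤ n * p + p),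
      lintegral_union measurableSet_Ioc (Ioc_disjoint_Ioc_of_le le_rfl), ih,
      setLIntegral_Ioc_eq_of_periodic hp hg (n * p) 0, zero_add, Nat.cast_succ, add_one_mul]

theorem setLIntegral_Ioc_comp_div_le_of_periodic {g : ℝ → ℝ≥0∞} {p : ℝ} (hp : 0 < p)
    (hg : Function.Periodic g p) {T r : ℝ} (hT : 0 < T) (hr : 0 < r) :
    ∫⁻ x in Ioc 0 T, g (x / r) ≤ ENNReal.ofReal (T / p + r) * ∫⁻ x in Ioc 0 p, g x := by
  have h := lintegral_image_eq_lintegral_abs_deriv_mul (s := Ioc 0 T) (f := fun x => x / r)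
    (f' := fun _ => 1 / r) measurableSet_Ioc
    (fun x _ => ((hasDerivAt_id x).div_const r).hasDerivWithinAt)
    (fun x _ y _ hxy => (div_left_inj' hr.ne').1 hxy) g
  rw [lintegral_const_mul' _ _ ENNReal.ofReal_ne_top, abs_of_pos (by positivity)] at h
  set n := ⌈T / r / p⌉₊
  have hsub : (fun x => x / r) '' Ioc 0 T ⊆ Ioc 0 (n * p) := by
    rintro _ ⟨x, ⟨hx0, hxT⟩, rfl⟩
    refine ⟨by positivity, ?_⟩
    calc x / r ≤ T / r := by gcongr
      _ = T / r / p * p := by field_simp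
      _ ≤ n * p := by gcongr; exact Nat.le_ceil _
  have hle : ENNReal.ofReal (1 / r) * ∫⁻ x in Ioc 0 T, g (x / r)
      ≤ n * ∫⁻ x in Ioc 0 p, g x := by
    rw [← h, ← setLIntegral_Ioc_nat_mul_of_periodic hp hg]
    exact lintegral_mono_set hsub
  calc ∫⁻ x in Ioc 0 T, g (x / r)
      = ENNReal.ofReal r * (ENNReal.ofReal (1 / r) * ∫⁻ x in Ioc 0 T, g (x / r)) := by
        rw [← mul_assoc, ← ENNReal.ofReal_mul hr.le, mul_one_div_cancel hr.ne',
          ENNReal.ofReal_one, one_mul]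
    _ ≤ ENNReal.ofReal r * (n * ∫⁻ x in Ioc 0 p, g x) := by gcongr
    _ = ENNReal.ofReal (r * n) * ∫⁻ x in Ioc 0 p, g x := by
        rw [← mul_assoc, ENNReal.ofReal_mul hr.le, ENNReal.ofReal_natCast]
    _ ≤ ENNReal.ofReal (T / p + r) * ∫⁻ x in Ioc 0 p, g x := by
        gcongr
        calc r * n ≤ r * (T / r / p + 1) := by
              gcongr; exact (Nat.ceil_lt_add_one (by positivity)).le
          _ = T / p + r := by field_simp

theorem setLIntegral_Ioc_comp_neg_div_le_of_periodic {g : ℝ → ℝ≥0∞} {p : ℝ} (hp : 0 < p)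
    (hg : Function.Periodic g p) {T r : ℝ} (hT : 0 < T) (hr : 0 < r) :
    ∫⁻ x in Ioc 0 T, g (-(x / r)) ≤ ENNReal.ofReal (T / p + r) * ∫⁻ x in Ioc 0 p, g x := by
  have hg' : Function.Periodic (fun x => g (-x)) p := fun x => by
    simpa only [neg_add'] using hg.sub_eq (-x)
  rw [← setLIntegral_Ioc_comp_neg_of_periodic hp hg]
  exact setLIntegral_Ioc_comp_div_le_of_periodic hp hg' hT hr

theorem rpow_le_rpow_abs_of_one_le {s A : ℝ} (hs : 1 ≤ s) (hsA : s ≤ A) (ε : ℝ) :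
    s ^ ε ≤ A ^ |ε| :=
  (Real.rpow_le_rpow_of_exponent_le hs (le_abs_self ε)).trans
    (Real.rpow_le_rpow (by linarith) hsA (abs_nonneg ε))

theorem setLIntegral_Ioi_le_of_inversion {A s : ℝ} (hs : 1 ≤ s) (hsA : s ≤ A) (ε : ℝ)
    (F : ℝ → ℝ≥0∞) :
    ∫⁻ a in Ioi A, F (s / a) * ENNReal.ofReal (a ^ ε) * ENNReal.ofReal a⁻¹ ≤
      ENNReal.ofReal (A ^ |ε|) *
        ∫⁻ b in Ioc 0 A, F b * ENNReal.ofReal (b ^ (-ε)) * ENNReal.ofReal b⁻¹ := by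
  have hs0 : 0 < s := by linarith
  have hA : 0 < A := by linarith
  have h := lintegral_image_eq_lintegral_abs_deriv_mul (s := Ioi A) (f := fun a => s / a)
    (f' := fun a => s * -(a ^ 2)⁻¹) measurableSet_Ioi
    (fun x hx => by
      have hx0 : x ≠ 0 := (hA.trans hx).ne'
      simpa [div_eq_mul_inv] using ((hasDerivAt_inv hx0).const_mul s).hasDerivWithinAt)
    (fun x hx y hy hxy => by
      have hx0 : x ≠ 0 := (hA.trans hx).ne'
      have hy0 : y ≠ 0 := (hA.trans hy).ne'
      have hxy : s / x = s / y := hxy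
      field_simp at hxy
      exact hxy.symm)
    (fun b => F b * ENNReal.ofReal (b ^ (-ε)) * ENNReal.ofReal b⁻¹)
  have hsub : (fun a => s / a) '' Ioi A ⊆ Ioc 0 A := by
    rintro _ ⟨a, ha, rfl⟩
    have ha : A < a := ha
    have ha0 : 0 < a := hA.trans ha
    refine ⟨by positivity, ?_⟩
    rw [div_le_iff₀ ha0]
    nlinarith
  calc _ = ∫⁻ a in Ioi A, ENNReal.ofReal (s ^ ε) * (ENNReal.ofReal |s * -(a ^ 2)⁻¹| *
        (F (s / a) * ENNReal.ofReal ((s / a) ^ (-ε)) * ENNReal.ofReal (s / a)⁻¹)) := by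
        refine setLIntegral_congr_fun measurableSet_Ioi fun a ha => ?_
        have ha0 : 0 < a := hA.trans ha
        have hreal : s ^ ε * (|s * -(a ^ 2)⁻¹| * ((s / a) ^ (-ε) * (s / a)⁻¹)) = a ^ ε * a⁻¹ := by
          rw [mul_neg, abs_neg, abs_of_pos (by positivity), Real.div_rpow hs0.le ha0.le,
            Real.rpow_neg hs0.le, Real.rpow_neg ha0.le]
          have := (Real.rpow_pos_of_pos hs0 ε).ne'
          have := (Real.rpow_pos_of_pos ha0 ε).ne'
          field_simp
        have hs1 : 0 ≤ s ^ ε := by positivity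
        have hs2 : 0 ≤ (s / a) ^ (-ε) := by positivity
        have ha1 : 0 ≤ a ^ ε := by positivity
        rw [mul_assoc, ← ENNReal.ofReal_mul ha1, ← hreal, ENNReal.ofReal_mul hs1,
          ENNReal.ofReal_mul (abs_nonneg _), ENNReal.ofReal_mul hs2]
        ring
    _ = ENNReal.ofReal (s ^ ε) * ∫⁻ b in (fun a => s / a) '' Ioi A,
        F b * ENNReal.ofReal (b ^ (-ε)) * ENNReal.ofReal b⁻¹ := by
        rw [lintegral_const_mul' _ _ ENNReal.ofReal_ne_top, h]
    _ ≤ _ := by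
        gcongr ENNReal.ofReal ?_ * ?_
        · exact rpow_le_rpow_abs_of_one_le hs hsA ε
        · exact lintegral_mono_set hsub

theorem lintegral_siegel_le_of_inversion_symm {p T₁ : ℝ} (hp : 0 < p) (hT₁ : 0 < T₁) (ε : ℝ)
    {Φ : ℝ → ℝ → ℝ≥0∞} (hΦ : Measurable (Function.uncurry Φ))
    (hper : ∀ a, Function.Periodic (Φ a) p)
    (hsymm : ∀ a T, 0 < a →
      Φ a (T / a ^ 2) = Φ (√(1 + T ^ 2) / a) (-(T / (√(1 + T ^ 2) / a) ^ 2))) :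
    ∫⁻ a in Ioi (0 : ℝ), ∫⁻ T in Ioc 0 T₁,
        Φ a (T / a ^ 2) * ENNReal.ofReal (a ^ ε) * ENNReal.ofReal a⁻¹ ≤
      ENNReal.ofReal ((T₁ / p + (1 + T₁ ^ 2)) * (1 + √(1 + T₁ ^ 2) ^ |ε|)) *
        ∫⁻ a in Ioc 0 √(1 + T₁ ^ 2), ENNReal.ofReal (a ^ ε + a ^ (-ε)) *
          (∫⁻ t in Ioc 0 p, Φ a t) * ENNReal.ofReal a⁻¹ := by
  set A := √(1 + T₁ ^ 2)
  have hA2 : A ^ 2 = 1 + T₁ ^ 2 := Real.sq_sqrt (by positivity)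
  have hA : 0 < A := by positivity
  set R := ∫⁻ a in Ioc 0 A, ENNReal.ofReal (a ^ ε + a ^ (-ε)) *
          (∫⁻ t in Ioc 0 p, Φ a t) * ENNReal.ofReal a⁻¹
  have hΦ' : ∀ {α : Type} [MeasurableSpace α] {u v : α → ℝ}, Measurable u → Measurable v →
      Measurable fun x => Φ (u x) (v x) := fun hu hv => hΦ.comp (hu.prodMk hv)
  have hlow : ∫⁻ a in Ioc 0 A, ∫⁻ T in Ioc 0 T₁,
        Φ a (T / a ^ 2) * ENNReal.ofReal (a ^ ε) * ENNReal.ofReal a⁻¹ ≤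
      ENNReal.ofReal (T₁ / p + (1 + T₁ ^ 2)) * R := by
    rw [← lintegral_const_mul' _ _ ENNReal.ofReal_ne_top]
    refine setLIntegral_mono' measurableSet_Ioc fun a ha => ?_
    have ha0 : 0 < a := ha.1
    rw [lintegral_mul_const' _ _ ENNReal.ofReal_ne_top,
      lintegral_mul_const' _ _ ENNReal.ofReal_ne_top]
    calc _ ≤ (ENNReal.ofReal (T₁ / p + a ^ 2) * ∫⁻ t in Ioc 0 p, Φ a t) *
          ENNReal.ofReal (a ^ ε) * ENNReal.ofReal a⁻¹ := by
          gcongr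
          exact setLIntegral_Ioc_comp_div_le_of_periodic hp (hper a) hT₁ (by positivity)
      _ ≤ (ENNReal.ofReal (T₁ / p + (1 + T₁ ^ 2)) * ∫⁻ t in Ioc 0 p, Φ a t) *
          ENNReal.ofReal (a ^ ε + a ^ (-ε)) * ENNReal.ofReal a⁻¹ := by
          rw [← hA2]
          gcongr
          · exact ha.2
          · exact le_add_of_nonneg_right (by positivity)
      _ = _ := by ring
  have hhigh : ∫⁻ a in Ioi A, ∫⁻ T in Ioc 0 T₁,
        Φ a (T / a ^ 2) * ENNReal.ofReal (a ^ ε) * ENNReal.ofReal a⁻¹ ≤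
      ENNReal.ofReal (A ^ |ε|) * (ENNReal.ofReal (T₁ / p + (1 + T₁ ^ 2)) * R) := by
    rw [lintegral_lintegral_swap (by
      refine Measurable.aemeasurable (((hΦ' ?_ ?_).mul ?_).mul ?_) <;> fun_prop)]
    calc _ ≤ ∫⁻ T in Ioc 0 T₁, ENNReal.ofReal (A ^ |ε|) * ∫⁻ b in Ioc 0 A,
          Φ b (-(T / b ^ 2)) * ENNReal.ofReal (b ^ (-ε)) * ENNReal.ofReal b⁻¹ := by
          refine setLIntegral_mono' measurableSet_Ioc fun T hT => ?_
          have hT0 : 0 < T := hT.1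
          refine le_trans (le_of_eq ?_) (setLIntegral_Ioi_le_of_inversion (s := √(1 + T ^ 2))
            (Real.one_le_sqrt.2 (by nlinarith))
            (Real.sqrt_le_sqrt (by have := hT.2; gcongr)) ε fun b => Φ b (-(T / b ^ 2)))
          refine setLIntegral_congr_fun measurableSet_Ioi fun a ha => ?_
          rw [hsymm a T (hA.trans ha)]
      _ = ENNReal.ofReal (A ^ |ε|) * ∫⁻ b in Ioc 0 A, ∫⁻ T in Ioc 0 T₁,
          Φ b (-(T / b ^ 2)) * ENNReal.ofReal (b ^ (-ε)) * ENNReal.ofReal b⁻¹ := by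
          rw [lintegral_const_mul' _ _ ENNReal.ofReal_ne_top, lintegral_lintegral_swap (by
            refine Measurable.aemeasurable (((hΦ' ?_ ?_).mul ?_).mul ?_) <;> fun_prop)]
      _ ≤ _ := by
          gcongr
          rw [← lintegral_const_mul' _ _ ENNReal.ofReal_ne_top]
          refine setLIntegral_mono' measurableSet_Ioc fun a ha => ?_
          have ha0 : 0 < a := ha.1
          rw [lintegral_mul_const' _ _ ENNReal.ofReal_ne_top,
            lintegral_mul_const' _ _ ENNReal.ofReal_ne_top]
          calc _ ≤ (ENNReal.ofReal (T₁ / p + a ^ 2) * ∫⁻ t in Ioc 0 p, Φ a t) *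
                ENNReal.ofReal (a ^ (-ε)) * ENNReal.ofReal a⁻¹ := by
                gcongr
                exact setLIntegral_Ioc_comp_neg_div_le_of_periodic hp (hper a) hT₁ (by positivity)
            _ ≤ (ENNReal.ofReal (T₁ / p + (1 + T₁ ^ 2)) * ∫⁻ t in Ioc 0 p, Φ a t) *
                ENNReal.ofReal (a ^ ε + a ^ (-ε)) * ENNReal.ofReal a⁻¹ := by
                rw [← hA2]
                gcongr
                · exact ha.2
                · exact le_add_of_nonneg_left (by positivity)
            _ = _ := by ring
  rw [← Ioc_union_Ioi_eq_Ioi hA.le,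
    lintegral_union measurableSet_Ioi (Ioc_disjoint_Ioi le_rfl)]
  refine (add_le_add hlow hhigh).trans (le_of_eq ?_)
  rw [ENNReal.ofReal_mul (by positivity), ENNReal.ofReal_add zero_le_one (by positivity),
    ENNReal.ofReal_one]
  ring

instance : BorelSpace SL2 := ⟨rfl⟩

theorem SL2.isInducing_coe :
    Topology.IsInducing fun x : SL2 => (x : Matrix (Fin 2) (Fin 2) ℝ) := ⟨rfl⟩

instance : SecondCountableTopology SL2 :=
  haveI : SecondCountableTopology (Matrix (Fin 2) (Fin 2) ℝ) :=
    inferInstanceAs (SecondCountableTopology (Fin 2 → Fin 2 → ℝ))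
  SL2.isInducing_coe.secondCountableTopology

instance : ContinuousMul SL2 where
  continuous_mul := SL2.isInducing_coe.continuous_iff.2 <| by
    rw [Function.comp_def]
    simp only [Matrix.SpecialLinearGroup.coe_mul]
    exact (SL2.isInducing_coe.continuous.comp continuous_fst).mul
      (SL2.isInducing_coe.continuous.comp continuous_snd)

theorem measurable_kRot : Measurable kRot := by
  refine (SL2.isInducing_coe.continuous_iff.2 ?_).measurable
  refine continuous_matrix fun i j => ?_
  fin_cases i <;> fin_cases j <;> simp [kRot] <;> fun_prop

theorem measurable_nMat : Measurable nMat := by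
  refine (SL2.isInducing_coe.continuous_iff.2 ?_).measurable
  refine continuous_matrix fun i j => ?_
  fin_cases i <;> fin_cases j <;> simp [nMat] <;> fun_prop

theorem coe_dMat {a : ℝ} (ha : a ≠ 0) :
    (dMat a : Matrix (Fin 2) (Fin 2) ℝ) = !![a, 0; 0, a⁻¹] := by
  simp [dMat, ha]

theorem measurable_dMat : Measurable dMat := by
  refine measurable_of_continuousOn_compl_singleton 0 ?_
  refine SL2.isInducing_coe.continuousOn_iff.2 ?_
  have h : ContinuousOn (fun a : ℝ => !![a, 0; 0, a⁻¹]) {0}ᶜ := by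
    refine continuousOn_pi.2 fun i => continuousOn_pi.2 fun j => ?_
    fin_cases i <;> fin_cases j <;> simp
    · exact continuousOn_id
    · exact continuousOn_const
    · exact continuousOn_const
    · exact continuousOn_inv₀
  exact h.congr fun a ha => coe_dMat ha

theorem nMat_mul_dMat (T : ℝ) {a : ℝ} (ha : a ≠ 0) :
    nMat T * dMat a = dMat a * nMat (T / a ^ 2) := by
  apply Subtype.ext
  rw [Matrix.SpecialLinearGroup.coe_mul, Matrix.SpecialLinearGroup.coe_mul, coe_dMat ha]
  ext i j
  fin_cases i <;> fin_cases j <;> simp [nMat]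
  field_simp

theorem nMat_add (s t : ℝ) : nMat (s + t) = nMat s * nMat t := by
  apply Subtype.ext
  rw [Matrix.SpecialLinearGroup.coe_mul]
  ext i j
  fin_cases i <;> fin_cases j <;> simp [nMat, add_comm]

theorem kRot_add (s t : ℝ) : kRot (s + t) = kRot s * kRot t := by
  apply Subtype.ext
  rw [Matrix.SpecialLinearGroup.coe_mul]
  ext i j
  fin_cases i <;> fin_cases j <;> simp [kRot, Real.cos_add, Real.sin_add] <;> ring

/-- Iwasawa decomposition of the translate of `n_T d_a` by the Weyl element. -/
theorem nMat_mul_dMat_mul_wMat (T : ℝ) {a : ℝ} (ha : a ≠ 0) :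
    nMat T * dMat a * wMat = kRot (-(π / 2 + Real.arctan T)) *
      (dMat (√(1 + T ^ 2) / a) * nMat (-(T / (√(1 + T ^ 2) / a) ^ 2))) := by
  have hs : 0 < √(1 + T ^ 2) := by positivity
  have hs2 : √(1 + T ^ 2) ^ 2 = 1 + T ^ 2 := Real.sq_sqrt (by positivity)
  have hcos : Real.cos (-(π / 2 + Real.arctan T)) = -(T / √(1 + T ^ 2)) := by
    rw [Real.cos_neg, add_comm, Real.cos_add_pi_div_two, Real.sin_arctan]
  have hsin : Real.sin (-(π / 2 + Real.arctan T)) = -(1 / √(1 + T ^ 2)) := by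
    rw [Real.sin_neg, add_comm, Real.sin_add_pi_div_two, Real.cos_arctan]
  apply Subtype.ext
  simp only [Matrix.SpecialLinearGroup.coe_mul]
  rw [coe_dMat ha, coe_dMat (div_ne_zero hs.ne' ha)]
  simp only [kRot, hcos, hsin, nMat, wMat]
  generalize √(1 + T ^ 2) = s at hs hs2 ⊢
  ext i j
  fin_cases i <;> fin_cases j <;> simp <;> field_simp
  · linear_combination hs2
  · ring

/-- The integral of `|f|²` over the circle `K d_a n_t`. -/
def circleEnergy (f : SL2 → ℂ) (a t : ℝ) : ℝ≥0∞ :=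
  ∫⁻ θ in Ioc (0 : ℝ) (2 * π), (‖f (kRot θ * dMat a * nMat t)‖₊ : ℝ≥0∞) ^ 2

theorem measurable_sq_nnnorm_comp {f : SL2 → ℂ} (hf : Measurable f)
    {α : Type*} [MeasurableSpace α] {u v w : α → ℝ} (hu : Measurable u) (hv : Measurable v)
    (hw : Measurable w) :
    Measurable fun x => (‖f (kRot (u x) * dMat (v x) * nMat (w x))‖₊ : ℝ≥0∞) ^ 2 := by
  have h : Measurable fun x => kRot (u x) * dMat (v x) * nMat (w x) :=
    ((measurable_kRot.comp hu).mul (measurable_dMat.comp hv)).mul (measurable_nMat.comp hw)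
  exact (hf.comp h).nnnorm.coe_nnreal_ennreal.pow_const 2

theorem measurable_circleEnergy {f : SL2 → ℂ} (hf : Measurable f) :
    Measurable (Function.uncurry (circleEnergy f)) :=
  Measurable.lintegral_prod_right' (f := fun q : (ℝ × ℝ) × ℝ =>
    (‖f (kRot q.2 * dMat q.1.1 * nMat q.1.2)‖₊ : ℝ≥0∞) ^ 2)
    (measurable_sq_nnnorm_comp hf measurable_snd measurable_fst.fst
      measurable_fst.snd)

theorem periodic_circleEnergy {f : SL2 → ℂ} {p : ℝ} (hper : ∀ x, f (x * nMat p) = f x) (a : ℝ) :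
    Function.Periodic (circleEnergy f a) p := fun t => by
  simp only [circleEnergy, nMat_add, ← mul_assoc, hper]

theorem circleEnergy_inversion {f : SL2 → ℂ} (hw : ∀ x, ‖f (x * wMat)‖ = ‖f x‖) {a : ℝ}
    (ha : a ≠ 0) (T : ℝ) :
    circleEnergy f a (T / a ^ 2) =
      circleEnergy f (√(1 + T ^ 2) / a) (-(T / (√(1 + T ^ 2) / a) ^ 2)) := by
  have hrot : Function.Periodic (fun θ => (‖f (kRot θ * dMat (√(1 + T ^ 2) / a) *
      nMat (-(T / (√(1 + T ^ 2) / a) ^ 2)))‖₊ : ℝ≥0∞) ^ 2) (2 * π) := fun θ => by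
    simp only [kRot_add_two_pi]
  simp only [circleEnergy]
  rw [← setLIntegral_Ioc_comp_add_right_of_periodic Real.two_pi_pos hrot
    (-(π / 2 + Real.arctan T))]
  refine lintegral_congr fun θ => ?_
  have h := hw (kRot θ * (nMat T * dMat a))
  rw [mul_assoc, nMat_mul_dMat_mul_wMat T ha, nMat_mul_dMat T ha, ← mul_assoc,
    ← kRot_add, ← mul_assoc, ← mul_assoc] at h
  have h' : ‖f (kRot θ * dMat a * nMat (T / a ^ 2))‖₊ = ‖f (kRot (θ + -(π / 2 + Real.arctan T)) *
      dMat (√(1 + T ^ 2) / a) * nMat (-(T / (√(1 + T ^ 2) / a) ^ 2)))‖₊ := NNReal.eq h.symm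
  rw [h']

theorem normXSq_eq_lintegral_circleEnergy {f : SL2 → ℂ} (hf : Measurable f) (T₁ ε : ℝ) :
    normXSq f T₁ ε = ∫⁻ a in Ioi (0 : ℝ), ∫⁻ T in Ioc 0 T₁,
      circleEnergy f a (T / a ^ 2) * ENNReal.ofReal (a ^ ε) * ENNReal.ofReal a⁻¹ := by
  calc _ = ∫⁻ θ in Ioc (0 : ℝ) (2 * π), ∫⁻ a in Ioi (0 : ℝ), ∫⁻ T in Ioc (0 : ℝ) T₁,
        (‖f (kRot θ * dMat a * nMat (T / a ^ 2))‖₊ : ℝ≥0∞) ^ 2 *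
          ENNReal.ofReal (a ^ ε) * ENNReal.ofReal a⁻¹ := by
        refine lintegral_congr fun θ => setLIntegral_congr_fun measurableSet_Ioi fun a ha => ?_
        have ha0 : a ≠ 0 := (show (0 : ℝ) < a from ha).ne'
        rw [← lintegral_mul_const' _ _ ENNReal.ofReal_ne_top]
        simp only [mul_assoc, nMat_mul_dMat _ ha0]
    _ = ∫⁻ a in Ioi (0 : ℝ), ∫⁻ θ in Ioc (0 : ℝ) (2 * π), ∫⁻ T in Ioc (0 : ℝ) T₁,
        (‖f (kRot θ * dMat a * nMat (T / a ^ 2))‖₊ : ℝ≥0∞) ^ 2 *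
          ENNReal.ofReal (a ^ ε) * ENNReal.ofReal a⁻¹ := by
        refine lintegral_lintegral_swap (Measurable.aemeasurable ?_)
        refine Measurable.lintegral_prod_right' (f := fun q : (ℝ × ℝ) × ℝ =>
          (‖f (kRot q.1.1 * dMat q.1.2 * nMat (q.2 / q.1.2 ^ 2))‖₊ : ℝ≥0∞) ^ 2 *
          ENNReal.ofReal (q.1.2 ^ ε) * ENNReal.ofReal q.1.2⁻¹) ?_
        refine ((measurable_sq_nnnorm_comp hf ?_ ?_ ?_).mul ?_).mul ?_ <;> fun_prop
    _ = _ := by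
        refine lintegral_congr fun a => ?_
        rw [lintegral_lintegral_swap (by
          refine Measurable.aemeasurable
            (((measurable_sq_nnnorm_comp hf ?_ ?_ ?_).mul ?_).mul ?_) <;> fun_prop)]
        refine lintegral_congr fun T => ?_
        rw [lintegral_mul_const' _ _ ENNReal.ofReal_ne_top,
          lintegral_mul_const' _ _ ENNReal.ofReal_ne_top, circleEnergy]

theorem lintegral_weighted_eq_lintegral_circleEnergy {f : SL2 → ℂ} (hf : Measurable f)
    (p A ε : ℝ) :
    (∫⁻ θ in Ioc (0 : ℝ) (2 * π), ∫⁻ a in Ioc (0 : ℝ) A,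
      ENNReal.ofReal (a ^ ε + a ^ (-ε)) *
        (∫⁻ t in Ioc (0 : ℝ) p, (‖f (kRot θ * dMat a * nMat t)‖₊ : ℝ≥0∞) ^ 2) *
        ENNReal.ofReal a⁻¹) =
      ∫⁻ a in Ioc 0 A, ENNReal.ofReal (a ^ ε + a ^ (-ε)) *
        (∫⁻ t in Ioc 0 p, circleEnergy f a t) * ENNReal.ofReal a⁻¹ := by
  rw [lintegral_lintegral_swap]
  · refine lintegral_congr fun a => ?_
    rw [lintegral_mul_const' _ _ ENNReal.ofReal_ne_top,
      lintegral_const_mul' _ _ ENNReal.ofReal_ne_top, lintegral_lintegral_swap]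
    · simp only [circleEnergy]
    · exact (measurable_sq_nnnorm_comp hf measurable_fst measurable_const
        measurable_snd).aemeasurable
  · refine Measurable.aemeasurable (Measurable.mul (Measurable.mul ?_ ?_) ?_)
    · fun_prop
    · exact Measurable.lintegral_prod_right' (f := fun q : (ℝ × ℝ) × ℝ =>
        (‖f (kRot q.1.1 * dMat q.1.2 * nMat q.2)‖₊ : ℝ≥0∞) ^ 2)
        (measurable_sq_nnnorm_comp hf measurable_fst.fst measurable_fst.snd
          measurable_snd)
    · fun_prop

/-- there is a constant `c > 0` depending only on `T₁, ε, p` such that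
`‖f‖²_{T₁,ε} ≤ c ∫₀^{2π} ∫₀^{√(1+T₁²)} (a^ε + a^{−ε}) (∫₀^p |f(k_θ d_a n_t)|² dt) da/a dθ`
for all right `N_p`-periodic `f` with `|f(xw)| = |f(x)|`. -/
theorem stmt4 (p : ℕ) (hp : 0 < p) (T₁ : ℝ) (hT₁ : 0 < T₁) (ε : ℝ) :
    ∃ c : ℝ, 0 < c ∧
      ∀ f : SL2 → ℂ, Measurable f → LocSqInt f →
        (∀ x : SL2, f (x * nMat (p : ℝ)) = f x) →
        (∀ x : SL2, ‖f (x * wMat)‖ = ‖f x‖) →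
        normXSq f T₁ ε ≤
          ENNReal.ofReal c *
            (∫⁻ θ in Ioc (0:ℝ) (2 * π), ∫⁻ a in Ioc (0:ℝ) (Real.sqrt (1 + T₁ ^ 2)),
              ENNReal.ofReal (a ^ ε + a ^ (-ε)) *
                (∫⁻ t in Ioc (0:ℝ) (p : ℝ), (‖f (kRot θ * dMat a * nMat t)‖₊ : ℝ≥0∞) ^ 2) *
                ENNReal.ofReal a⁻¹) := by
  have hp' : (0 : ℝ) < p := Nat.cast_pos.2 hp
  refine ⟨(T₁ / p + (1 + T₁ ^ 2)) * (1 + √(1 + T₁ ^ 2) ^ |ε|), by positivity, ?_⟩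
  intro f hf _ hper hw
  rw [normXSq_eq_lintegral_circleEnergy hf, lintegral_weighted_eq_lintegral_circleEnergy hf]
  exact lintegral_siegel_le_of_inversion_symm hp' hT₁ ε (measurable_circleEnergy hf)
    (periodic_circleEnergy hper) fun a T ha => circleEnergy_inversion hw ha.ne' T
end
end

section
/- Fix a positive integer p, u = u₀ + iu₁ ∈ ℂ with u₀ = Re(u) < 1, complex coefficients (b_m)_{m ∈ ℤ∖{0}} of at most polynomial growth, and a continuous rapidly decreasing ψ : ℝ → ℂ. Define f_ψ(a,t) = a^{−1−u} Σ_{m ∈ ℤ, m ≠ 0} ψ(−(m/p) a^{−2}) b_m e^{−2πi t m/p}. Then for every ε ∈ ℝ and every a₁ ∈ (0,∞), the following equality holds in [0,∞]: ∫₀^{a₁} ∫₀^{p} |f_ψ(a,t)|² dt a^{ε} da/a = (p/2) Σ_{σ ∈ {+1,−1}} ∫_{1/(a₁² p)}^{∞} a^{−ε/2 + u₀} |ψ(−σ a)|² ( Σ_{m ≥ 1, m/p ≤ a a₁²} (m/p)^{ε/2 − 1 − u₀} |b_{σ m}|² ) da. In particular (letting a₁ → ∞): ∫₀^{∞} ∫₀^{p}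 |f_ψ(a,t)|² dt a^{ε} da/a = (p/2) Σ_{σ ∈ {+1,−1}} ( Σ_{m ≥ 1} (m/p)^{ε/2 − 1 − u₀} |b_{σ m}|² ) ∫₀^{∞} a^{−ε/2 + u₀} |ψ(−σ a)|² da. -/
open MeasureTheory Real Set
open scoped ENNReal NNReal

noncomputable section

/-- `ψ : ℝ → ℂ` is rapidly decreasing: `sup_x (1+|x|)^k ‖ψ x‖ < ∞` for every `k`. -/
def RapidDecay (ψ : ℝ → ℂ) : Prop :=
  ∀ k : ℕ, ∃ C : ℝ, ∀ x : ℝ, (1 + |x|) ^ k * ‖ψ x‖ ≤ C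

/-- Coefficients `(b_m)` of at most polynomial growth. -/
def PolyGrowth (b : ℤ → ℂ) : Prop :=
  ∃ C N : ℝ, ∀ m : ℤ, ‖b m‖ ≤ C * (1 + |(m : ℝ)|) ^ N

/-- The Fourier–Whittaker series
`f_ψ(a,t) = a^{−1−u} Σ_{m ≠ 0} ψ(−(m/p) a^{−2}) b_m e^{−2πi t m/p}`
(the `m = 0` term vanishes since `b 0 = 0` in all statements below). -/
def fW (p : ℕ) (u : ℂ) (b : ℤ → ℂ) (ψ : ℝ → ℂ) (a t : ℝ) : ℂ :=
  (a : ℂ) ^ (-1 - u) *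
    ∑' m : ℤ, ψ (-((m : ℝ) / (p : ℝ)) * a ^ (-2 : ℤ)) * b m *
      Complex.exp (-2 * (π : ℂ) * Complex.I * (t : ℂ) * (m : ℂ) / (p : ℂ))

/-- The weighted `L²`-norm `∫_s ∫₀^p |f_ψ(a,t)|² dt a^ε da/a` over a set `s` of `a`'s. -/
def lhsInt (p : ℕ) (u : ℂ) (b : ℤ → ℂ) (ψ : ℝ → ℂ) (ε : ℝ) (s : Set ℝ) : ℝ≥0∞ :=
  ∫⁻ a in s,
    (∫⁻ t in Ioc (0:ℝ) (p : ℝ), (‖fW p u b ψ a t‖₊ : ℝ≥0∞) ^ 2) *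
      ENNReal.ofReal (a ^ ε) * ENNReal.ofReal a⁻¹

/-- The partial coefficient sum `Σ_{m ≥ 1, m/p ≤ c} (m/p)^{ε/2−1−u₀} |b_{σm}|²`. -/
def coefSum (p : ℕ) (u : ℂ) (b : ℤ → ℂ) (ε : ℝ) (σ : ℤ) (c : ℝ) : ℝ≥0∞ :=
  ∑' m : ℕ,
    if 1 ≤ m ∧ (m : ℝ) / (p : ℝ) ≤ c then
      ENNReal.ofReal (((m : ℝ) / (p : ℝ)) ^ (ε / 2 - 1 - u.re)) *
        (‖b (σ * (m : ℤ))‖₊ : ℝ≥0∞) ^ 2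
    else 0

/-- The full coefficient sum `Σ_{m ≥ 1} (m/p)^{ε/2−1−u₀} |b_{σm}|²`. -/
def coefSumFull (p : ℕ) (u : ℂ) (b : ℤ → ℂ) (ε : ℝ) (σ : ℤ) : ℝ≥0∞ :=
  ∑' m : ℕ,
    if 1 ≤ m then
      ENNReal.ofReal (((m : ℝ) / (p : ℝ)) ^ (ε / 2 - 1 - u.re)) *
        (‖b (σ * (m : ℤ))‖₊ : ℝ≥0∞) ^ 2
    else 0

theorem fourierBasis_repr_of_hasSum {T : ℝ} [hT : Fact (0 < T)] {c : ℤ → ℂ}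
    {f : Lp ℂ 2 (@AddCircle.haarAddCircle T hT)}
    (h : HasSum (fun n => c n • (fourierBasis : HilbertBasis ℤ ℂ _) n) f) (i : ℤ) :
    fourierBasis.repr f i = c i := by
  classical
  have h1 := (innerSL ℂ ((fourierBasis : HilbertBasis ℤ ℂ
    (Lp ℂ 2 (@AddCircle.haarAddCircle T hT))) i)).hasSum h
  rw [HilbertBasis.repr_apply_apply]
  refine h1.unique ?_
  refine (hasSum_ite_eq i (c i)).congr_fun fun n => ?_
  have ho := (orthonormal_iff_ite.mp
    (fourierBasis : HilbertBasis ℤ ℂ (Lp ℂ 2 (@AddCircle.haarAddCircle T hT))).orthonormal) i n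
  rw [innerSL_apply_apply, inner_smul_right, ho]
  by_cases hn : n = i
  · simp [hn]
  · simp [hn, Ne.symm hn]

theorem lintegral_haarAddCircle_sq_tsum_fourier {T : ℝ} [hT : Fact (0 < T)] {c : ℤ → ℂ}
    (hc : Summable fun n => ‖c n‖) :
    ∫⁻ x : AddCircle T, ‖∑' n, c n * fourier n x‖ₑ ^ 2 ∂AddCircle.haarAddCircle =
      ∑' n, ‖c n‖ₑ ^ 2 := by
  have hs : Summable fun n => c n • (fourier n : C(AddCircle T, ℂ)) :=
    Summable.of_norm (by simpa only [norm_smul, fourier_norm, mul_one] using hc)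
  obtain ⟨F, hF⟩ := hs
  have hFx (x : AddCircle T) : ∑' n, c n * fourier n x = F x := by
    have := (ContinuousMap.hasSum_apply hF x).tsum_eq
    simpa using this
  simp_rw [hFx]
  set L := ContinuousMap.toLp (E := ℂ) 2 (@AddCircle.haarAddCircle T hT) ℂ F with hL
  have hLs : HasSum (fun n => c n • (fourierBasis : HilbertBasis ℤ ℂ
      (Lp ℂ 2 (@AddCircle.haarAddCircle T hT))) n) L := by
    have := (ContinuousMap.toLp (E := ℂ) 2 (@AddCircle.haarAddCircle T hT) ℂ).hasSum hF
    simpa [Function.comp_def, fourierLp] using this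
  have hp := hasSum_sq_fourierCoeff L
  simp_rw [← fourierBasis_repr, fourierBasis_repr_of_hasSum hLs] at hp
  have hae : (fun t => ‖L t‖ ^ 2) =ᵐ[AddCircle.haarAddCircle] fun t => ‖F t‖ ^ 2 := by
    filter_upwards [ContinuousMap.coeFn_toLp (p := 2) (𝕜 := ℂ)
      (@AddCircle.haarAddCircle T hT) F] with x hx
    rw [hL, hx]
  rw [integral_congr_ae hae] at hp
  have hint : Integrable (fun t => ‖F t‖ ^ 2) (@AddCircle.haarAddCircle T hT) :=
    (by fun_prop : Continuous fun t => ‖F t‖ ^ 2).integrable_of_hasCompactSupport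
      (HasCompactSupport.of_compactSpace _)
  have hE (z : ℂ) : ‖z‖ₑ ^ 2 = ENNReal.ofReal (‖z‖ ^ 2) := by
    rw [ENNReal.ofReal_pow (norm_nonneg _), ofReal_norm]
  simp_rw [hE]
  rw [← ofReal_integral_eq_lintegral_ofReal hint (.of_forall fun _ => by positivity),
    ← hp.tsum_eq, ENNReal.ofReal_tsum_of_nonneg (fun _ => by positivity) hp.summable]

theorem lintegral_Ioc_sq_tsum_exp {T : ℝ} (hT : 0 < T) {c : ℤ → ℂ}
    (hc : Summable fun n => ‖c n‖) :
    ∫⁻ t in Ioc 0 T, ‖∑' m : ℤ, c m *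
        Complex.exp (-2 * (π : ℂ) * Complex.I * (t : ℂ) * (m : ℂ) / (T : ℂ))‖ₑ ^ 2 =
      ENNReal.ofReal T * ∑' m, ‖c m‖ₑ ^ 2 := by
  have : Fact (0 < T) := ⟨hT⟩
  have hc' : Summable fun n => ‖c (-n)‖ := (Equiv.neg ℤ).summable_iff.mpr hc
  have key (t : ℝ) : ∑' m : ℤ, c m *
      Complex.exp (-2 * (π : ℂ) * Complex.I * (t : ℂ) * (m : ℂ) / (T : ℂ)) =
      ∑' n : ℤ, c (-n) * fourier n (t : AddCircle T) := by
    rw [← (Equiv.neg ℤ).tsum_eq]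
    refine tsum_congr fun n => ?_
    rw [fourier_coe_apply]
    simp only [Equiv.neg_apply]
    congr 2
    push_cast
    ring
  simp_rw [key]
  have := AddCircle.lintegral_preimage T 0
    (fun x : AddCircle T => ‖∑' n : ℤ, c (-n) * fourier n x‖ₑ ^ 2)
  rw [zero_add] at this
  rw [this, AddCircle.volume_eq_smul_haarAddCircle, lintegral_smul_measure,
    lintegral_haarAddCircle_sq_tsum_fourier hc', smul_eq_mul,
    ← (Equiv.neg ℤ).tsum_eq (fun m => ‖c m‖ₑ ^ 2)]
  rfl

theorem summable_norm_mul_of_rapidDecay {b : ℤ → ℂ} (hb0 : b 0 = 0) (hb : PolyGrowth b)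
    {ψ : ℝ → ℂ} (hψ : RapidDecay ψ) {r : ℝ} (hr : r ≠ 0) :
    Summable fun m : ℤ => ‖ψ (m * r) * b m‖ := by
  obtain ⟨C, N, hC⟩ := hb
  obtain ⟨n, hn⟩ := exists_nat_ge N
  obtain ⟨D, hD⟩ := hψ (n + 2)
  have hr' : 0 < |r| := abs_pos.mpr hr
  refine Summable.of_nonneg_of_le (fun _ => norm_nonneg _) (fun m => ?_)
    ((Real.summable_one_div_int_pow (p := 2)).mpr one_lt_two |>.mul_left
      (D / |r| ^ (n + 2) * (|C| * 2 ^ n)))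
  rcases eq_or_ne m 0 with rfl | hm
  · simp [hb0]
  have hm1 : (1 : ℝ) ≤ |(m : ℝ)| := by exact_mod_cast Int.one_le_abs hm
  have hm0 : (0 : ℝ) < |(m : ℝ)| := by linarith
  have h1 : ‖ψ (m * r)‖ ≤ D / (|(m : ℝ)| * |r|) ^ (n + 2) := by
    rw [le_div_iff₀ (by positivity), mul_comm, ← abs_mul]
    refine le_trans ?_ (hD (m * r))
    gcongr
    linarith
  have h2 : ‖b m‖ ≤ |C| * (2 * |(m : ℝ)|) ^ n := by
    refine (hC m).trans ?_
    have h3 : (1 + |(m : ℝ)|) ^ N ≤ (2 * |(m : ℝ)|) ^ n := by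
      calc (1 + |(m : ℝ)|) ^ N ≤ (1 + |(m : ℝ)|) ^ (n : ℝ) :=
            Real.rpow_le_rpow_of_exponent_le (by linarith) hn
        _ = (1 + |(m : ℝ)|) ^ n := Real.rpow_natCast _ _
        _ ≤ (2 * |(m : ℝ)|) ^ n := by gcongr; linarith
    gcongr
    exact le_abs_self C
  rw [norm_mul]
  calc ‖ψ (m * r)‖ * ‖b m‖
      ≤ D / (|(m : ℝ)| * |r|) ^ (n + 2) * (|C| * (2 * |(m : ℝ)|) ^ n) :=
        mul_le_mul h1 h2 (norm_nonneg _) ((norm_nonneg _).trans h1)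
    _ = D / |r| ^ (n + 2) * (|C| * 2 ^ n) * (1 / (m : ℝ) ^ 2) := by
        rw [← sq_abs (m : ℝ), mul_pow, mul_pow]
        field_simp
        ring

theorem lintegral_mul_comp_mul_zpow {x : ℝ} (hx : 0 < x) {s : Set ℝ} (hs : MeasurableSet s)
    (hs0 : s ⊆ Ioi 0) (v ε : ℝ) (φ : ℝ → ℝ≥0∞) :
    ∫⁻ a in s, ENNReal.ofReal (a ^ (-2 - 2 * v)) * φ (x * a ^ (-2 : ℤ)) *
        ENNReal.ofReal (a ^ ε) * ENNReal.ofReal a⁻¹ =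
      ENNReal.ofReal (1 / 2) * ENNReal.ofReal (x ^ (ε / 2 - 1 - v)) *
        ∫⁻ y in (fun a => x * a ^ (-2 : ℤ)) '' s, ENNReal.ofReal (y ^ (-ε / 2 + v)) * φ y := by
  have hderiv : ∀ a ∈ s, HasDerivWithinAt (fun a : ℝ => x * a ^ (-2 : ℤ))
      (x * ((-2 : ℤ) * a ^ (-2 - 1 : ℤ))) s a := fun a ha =>
    ((hasDerivAt_zpow (-2) a (.inl (hs0 ha).ne')).const_mul x).hasDerivWithinAt
  have hinj : InjOn (fun a : ℝ => x * a ^ (-2 : ℤ)) s := by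
    intro a ha c hc hac
    have ha0 : 0 < a := hs0 ha
    have hc0 : 0 < c := hs0 hc
    have h1 : a ^ (-2 : ℤ) = c ^ (-2 : ℤ) := mul_left_cancel₀ hx.ne' hac
    rw [zpow_neg, zpow_neg, inv_inj] at h1
    exact (pow_left_inj₀ ha0.le hc0.le two_ne_zero).mp (by exact_mod_cast h1)
  rw [lintegral_image_eq_lintegral_abs_deriv_mul hs hderiv hinj,
    ← lintegral_const_mul' _ _ (ENNReal.mul_ne_top ENNReal.ofReal_ne_top ENNReal.ofReal_ne_top)]
  refine setLIntegral_congr_fun hs fun a ha => ?_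
  have ha0 : 0 < a := hs0 ha
  have hreal : a ^ (-2 - 2 * v) * a ^ ε * a⁻¹ = 1 / 2 * x ^ (ε / 2 - 1 - v) *
      |x * ((-2 : ℤ) * a ^ (-2 - 1 : ℤ))| * (x * a ^ (-2 : ℤ)) ^ (-ε / 2 + v) := by
    have hz3 : a ^ (-2 - 1 : ℤ) = a ^ (-3 : ℝ) := by
      rw [← Real.rpow_intCast]; norm_num
    have hz2 : a ^ (-2 : ℤ) = a ^ (-2 : ℝ) := by
      rw [← Real.rpow_intCast]; norm_num
    rw [hz3, hz2, Real.mul_rpow hx.le (by positivity), ← Real.rpow_mul ha0.le,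
      abs_mul, abs_mul, abs_of_pos hx, abs_of_pos (Real.rpow_pos_of_pos ha0 _),
      ← Real.rpow_neg_one a, ← Real.rpow_add ha0, ← Real.rpow_add ha0]
    have hxx : x ^ (ε / 2 - 1 - v) * x * x ^ (-ε / 2 + v) = 1 := by
      nth_rw 2 [← Real.rpow_one x]
      rw [← Real.rpow_add hx, ← Real.rpow_add hx]
      ring_nf
      exact Real.rpow_zero x
    have haa : a ^ (-3 : ℝ) * a ^ (-2 * (-ε / 2 + v)) = a ^ (-2 - 2 * v + ε + -1) := by
      rw [← Real.rpow_add ha0]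
      ring_nf
    rw [← haa]
    have h2 : |((-2 : ℤ) : ℝ)| = 2 := by norm_num
    rw [h2]
    linear_combination (- a ^ (-3 : ℝ) * a ^ (-2 * (-ε / 2 + v))) * hxx
  have hE := congrArg ENNReal.ofReal hreal
  rw [ENNReal.ofReal_mul (by positivity), ENNReal.ofReal_mul (by positivity),
    ENNReal.ofReal_mul (by positivity), ENNReal.ofReal_mul (by positivity),
    ENNReal.ofReal_mul (by positivity)] at hE
  calc _ = (ENNReal.ofReal (a ^ (-2 - 2 * v)) * ENNReal.ofReal (a ^ ε) * ENNReal.ofReal a⁻¹) *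
        φ (x * a ^ (-2 : ℤ)) := by ring
    _ = _ := by rw [hE]; ring

theorem image_mul_zpow_Ioi {x : ℝ} (hx : 0 < x) :
    (fun a : ℝ => x * a ^ (-2 : ℤ)) '' Ioi 0 = Ioi 0 := by
  ext y
  constructor
  · rintro ⟨a, ha, rfl⟩
    have ha0 : 0 < a := ha
    exact mul_pos hx (by positivity)
  · intro hy
    have hy0 : 0 < y := hy
    refine ⟨√(x / y), Real.sqrt_pos.mpr (by positivity), ?_⟩
    have : √(x / y) ^ 2 = x / y := Real.sq_sqrt (by positivity)
    simp only [zpow_neg]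
    norm_cast
    rw [this]
    field_simp

theorem image_mul_zpow_Ioc {x a₁ : ℝ} (hx : 0 < x) (ha₁ : 0 < a₁) :
    (fun a : ℝ => x * a ^ (-2 : ℤ)) '' Ioc 0 a₁ = Ici (x / a₁ ^ 2) := by
  have hz (a : ℝ) : x * a ^ (-2 : ℤ) = x / a ^ 2 := by
    rw [zpow_neg, div_eq_mul_inv]
    norm_cast
  simp_rw [hz]
  ext y
  constructor
  · rintro ⟨a, ⟨ha0, ha⟩, rfl⟩
    simp only [mem_Ici]
    gcongr
  · intro hy
    have hy' : x / a₁ ^ 2 ≤ y := hy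
    have hy0 : 0 < y := lt_of_lt_of_le (by positivity) hy'
    refine ⟨√(x / y), ⟨Real.sqrt_pos.mpr (by positivity), ?_⟩, ?_⟩
    · rw [Real.sqrt_le_left ha₁.le]
      rw [div_le_iff₀ (by positivity)] at hy' ⊢
      linarith
    · simp only [Real.sq_sqrt (show 0 ≤ x / y by positivity)]
      field_simp

theorem lintegral_sq_fW {p : ℕ} (hp : 0 < p) (u : ℂ) {b : ℤ → ℂ} (hb0 : b 0 = 0)
    (hb : PolyGrowth b) {ψ : ℝ → ℂ} (hψ : RapidDecay ψ) {a : ℝ} (ha : 0 < a) :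
    ∫⁻ t in Ioc (0 : ℝ) p, (‖fW p u b ψ a t‖₊ : ℝ≥0∞) ^ 2 =
      ENNReal.ofReal p * ∑' m : ℤ, ‖b m‖ₑ ^ 2 *
        (ENNReal.ofReal (a ^ (-2 - 2 * u.re)) *
          ‖ψ (-((m : ℝ) / (p : ℝ)) * a ^ (-2 : ℤ))‖ₑ ^ 2) := by
  have hp0 : (0 : ℝ) < p := by exact_mod_cast hp
  have hsum : Summable fun m : ℤ => ‖ψ (-((m : ℝ) / (p : ℝ)) * a ^ (-2 : ℤ)) * b m‖ := by
    have hr : -(a ^ (-2 : ℤ) / p) ≠ 0 := by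
      have : 0 < a ^ (-2 : ℤ) / p := by positivity
      linarith
    refine (summable_norm_mul_of_rapidDecay hb0 hb hψ hr).congr fun m => ?_
    congr 3
    ring
  have hP := lintegral_Ioc_sq_tsum_exp hp0 hsum
  have hcpow : ‖(a : ℂ) ^ (-1 - u)‖ₑ ^ 2 = ENNReal.ofReal (a ^ (-2 - 2 * u.re)) := by
    rw [← ofReal_norm, Complex.norm_cpow_eq_rpow_re_of_pos ha,
      ← ENNReal.ofReal_pow (by positivity), ← Real.rpow_natCast, ← Real.rpow_mul ha.le]
    congr 2
    simp
    ring
  simp_rw [fW, ← enorm_eq_nnnorm, enorm_mul, mul_pow, hcpow]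
  rw [lintegral_const_mul' _ _ ENNReal.ofReal_ne_top]
  push_cast at hP
  rw [hP, ← mul_assoc, mul_comm _ (ENNReal.ofReal (p : ℝ)), mul_assoc, ← ENNReal.tsum_mul_left]
  congr 1
  refine tsum_congr fun m => ?_
  rw [enorm_mul, mul_pow]
  ring

theorem lhsInt_eq_tsum_int {p : ℕ} (hp : 0 < p) (u : ℂ) {b : ℤ → ℂ} (hb0 : b 0 = 0)
    (hb : PolyGrowth b) {ψ : ℝ → ℂ} (hψc : Continuous ψ) (hψ : RapidDecay ψ) (ε : ℝ)
    {s : Set ℝ} (hs : MeasurableSet s) (hs0 : s ⊆ Ioi 0) :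
    lhsInt p u b ψ ε s = ENNReal.ofReal p * ∑' m : ℤ, ‖b m‖ₑ ^ 2 *
      ∫⁻ a in s, ENNReal.ofReal (a ^ (-2 - 2 * u.re)) *
        ‖ψ (-((m : ℝ) / (p : ℝ)) * a ^ (-2 : ℤ))‖ₑ ^ 2 *
          ENNReal.ofReal (a ^ ε) * ENNReal.ofReal a⁻¹ := by
  have hψm := hψc.measurable
  have hmeas (m : ℤ) : Measurable fun a : ℝ => ENNReal.ofReal (a ^ (-2 - 2 * u.re)) *
      ‖ψ (-((m : ℝ) / (p : ℝ)) * a ^ (-2 : ℤ))‖ₑ ^ 2 *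
        ENNReal.ofReal (a ^ ε) * ENNReal.ofReal a⁻¹ := by
    fun_prop
  simp_rw [← lintegral_const_mul _ (hmeas _)]
  rw [← lintegral_tsum fun m => ((hmeas m).const_mul _).aemeasurable,
    ← lintegral_const_mul' _ _ ENNReal.ofReal_ne_top, lhsInt]
  refine setLIntegral_congr_fun hs fun a ha => ?_
  rw [lintegral_sq_fW hp u hb0 hb hψ (hs0 ha), mul_assoc, mul_assoc, ← ENNReal.tsum_mul_right]
  congr 1
  refine tsum_congr fun m => ?_
  ring

theorem ENNReal.tsum_int_eq_add_of_zero {f : ℤ → ℝ≥0∞} (h0 : f 0 = 0) :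
    ∑' m, f m = (∑' n : ℕ, if 1 ≤ n then f n else 0) +
      ∑' n : ℕ, if 1 ≤ n then f (-n) else 0 := by
  rw [tsum_of_nat_of_neg_add_one ENNReal.summable ENNReal.summable]
  congr 1
  · refine tsum_congr fun n => ?_
    split_ifs with h
    · rfl
    · obtain rfl : n = 0 := by omega
      simpa using h0
  · rw [tsum_eq_zero_add' (f := fun n : ℕ => if 1 ≤ n then f (-n) else 0) ENNReal.summable]
    simp only [nonpos_iff_eq_zero, one_ne_zero, if_false, zero_add, le_add_iff_nonneg_left,
      zero_le, if_true, Nat.cast_add, Nat.cast_one]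

theorem lhsInt_eq_tsum_nat {p : ℕ} (hp : 0 < p) (u : ℂ) {b : ℤ → ℂ} (hb0 : b 0 = 0)
    (hb : PolyGrowth b) {ψ : ℝ → ℂ} (hψc : Continuous ψ) (hψ : RapidDecay ψ) (ε : ℝ)
    {s : Set ℝ} (hs : MeasurableSet s) (hs0 : s ⊆ Ioi 0) :
    lhsInt p u b ψ ε s = ENNReal.ofReal ((p : ℝ) / 2) *
      ((∑' n : ℕ, if 1 ≤ n then ENNReal.ofReal (((n : ℝ) / p) ^ (ε / 2 - 1 - u.re)) *
          ‖b n‖ₑ ^ 2 * ∫⁻ y in (fun a => ((n : ℝ) / p) * a ^ (-2 : ℤ)) '' s,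
            ENNReal.ofReal (y ^ (-ε / 2 + u.re)) * ‖ψ (-y)‖ₑ ^ 2 else 0) +
        ∑' n : ℕ, if 1 ≤ n then ENNReal.ofReal (((n : ℝ) / p) ^ (ε / 2 - 1 - u.re)) *
          ‖b (-n)‖ₑ ^ 2 * ∫⁻ y in (fun a => ((n : ℝ) / p) * a ^ (-2 : ℤ)) '' s,
            ENNReal.ofReal (y ^ (-ε / 2 + u.re)) * ‖ψ y‖ₑ ^ 2 else 0) := by
  have hp0 : (0 : ℝ) < p := by exact_mod_cast hp
  rw [lhsInt_eq_tsum_int hp u hb0 hb hψc hψ ε hs hs0,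
    ENNReal.tsum_int_eq_add_of_zero (by simp [hb0]), div_eq_mul_one_div,
    ENNReal.ofReal_mul hp0.le, mul_assoc, mul_add (ENNReal.ofReal (1 / 2)),
    ← ENNReal.tsum_mul_left, ← ENNReal.tsum_mul_left]
  congr 3 <;> ext n <;> split_ifs with hn
  · have hx : (0 : ℝ) < n / p := div_pos (by exact_mod_cast hn) hp0
    have := lintegral_mul_comp_mul_zpow hx hs hs0 u.re ε (fun y => ‖ψ (-y)‖ₑ ^ 2)
    simp only [← neg_mul] at this
    simp only [Int.cast_natCast, this]
    ring
  · simp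
  · have hx : (0 : ℝ) < n / p := div_pos (by exact_mod_cast hn) hp0
    have := lintegral_mul_comp_mul_zpow hx hs hs0 u.re ε (fun y => ‖ψ y‖ₑ ^ 2)
    simp only [Int.cast_neg, Int.cast_natCast, neg_div, neg_neg, this]
    ring
  · simp

theorem lintegral_mul_coefSum {p : ℕ} (hp : 0 < p) (u : ℂ) (b : ℤ → ℂ) (ε : ℝ) (σ : ℤ)
    {a₁ : ℝ} (ha₁ : 0 < a₁) {g : ℝ → ℝ≥0∞} (hg : Measurable g) :
    ∫⁻ a in Ioi (1 / (a₁ ^ 2 * (p : ℝ))), g a * coefSum p u b ε σ (a * a₁ ^ 2) =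
      ∑' n : ℕ, if 1 ≤ n then ENNReal.ofReal (((n : ℝ) / p) ^ (ε / 2 - 1 - u.re)) *
        ‖b (σ * n)‖ₑ ^ 2 * ∫⁻ y in Ici (((n : ℝ) / p) / a₁ ^ 2), g y else 0 := by
  have hp0 : (0 : ℝ) < p := by exact_mod_cast hp
  have hterm (a : ℝ) : g a * coefSum p u b ε σ (a * a₁ ^ 2) =
      ∑' n : ℕ, if 1 ≤ n then ENNReal.ofReal (((n : ℝ) / p) ^ (ε / 2 - 1 - u.re)) *
        ‖b (σ * n)‖ₑ ^ 2 * (Ici (((n : ℝ) / p) / a₁ ^ 2)).indicator g a else 0 := by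
    rw [coefSum, ← ENNReal.tsum_mul_left]
    refine tsum_congr fun n => ?_
    have hiff : (n : ℝ) / p ≤ a * a₁ ^ 2 ↔ a ∈ Ici (((n : ℝ) / p) / a₁ ^ 2) := by
      rw [mem_Ici, div_le_iff₀ (by positivity : 0 < a₁ ^ 2)]
    simp only [hiff, indicator_apply]
    by_cases h1 : 1 ≤ n <;> by_cases h2 : a ∈ Ici (((n : ℝ) / p) / a₁ ^ 2) <;>
      simp [h1, h2, enorm_eq_nnnorm, mul_comm]
  simp_rw [hterm]
  rw [lintegral_tsum fun n => ?_]
  · refine tsum_congr fun n => ?_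
    split_ifs with hn
    · rw [lintegral_const_mul _ (hg.indicator measurableSet_Ici),
        setLIntegral_congr Ioi_ae_eq_Ici, setLIntegral_indicator measurableSet_Ici,
        inter_eq_left.mpr]
      refine Ici_subset_Ici.mpr ?_
      have hn' : (1 : ℝ) ≤ n := by exact_mod_cast hn
      rw [div_div, mul_comm (p : ℝ)]
      gcongr
    · simp
  · split_ifs
    · exact ((hg.indicator measurableSet_Ici).const_mul _).aemeasurable
    · exact aemeasurable_const

/-- the exact unfolded formula for `∫₀^{a₁} ∫₀^p |f_ψ|² dt a^ε da/a`
(both for finite `a₁` and for `a₁ = ∞`), as equalities in `[0,∞]`. -/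
theorem stmt6 (p : ℕ) (hp : 0 < p) (u : ℂ) (hu : u.re < 1)
    (b : ℤ → ℂ) (hb0 : b 0 = 0) (hb : PolyGrowth b)
    (ψ : ℝ → ℂ) (hψc : Continuous ψ) (hψ : RapidDecay ψ) (ε : ℝ) :
    (∀ a₁ : ℝ, 0 < a₁ →
      lhsInt p u b ψ ε (Ioc (0:ℝ) a₁)
        = ENNReal.ofReal ((p : ℝ) / 2) *
            ((∫⁻ a in Ioi (1 / (a₁ ^ 2 * (p : ℝ))),
                ENNReal.ofReal (a ^ (-ε / 2 + u.re)) * (‖ψ (-a)‖₊ : ℝ≥0∞) ^ 2 *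
                  coefSum p u b ε 1 (a * a₁ ^ 2))
              + (∫⁻ a in Ioi (1 / (a₁ ^ 2 * (p : ℝ))),
                  ENNReal.ofReal (a ^ (-ε / 2 + u.re)) * (‖ψ a‖₊ : ℝ≥0∞) ^ 2 *
                    coefSum p u b ε (-1) (a * a₁ ^ 2)))) ∧
    lhsInt p u b ψ ε (Ioi (0:ℝ))
      = ENNReal.ofReal ((p : ℝ) / 2) *
          (coefSumFull p u b ε 1 *
              (∫⁻ a in Ioi (0:ℝ),
                ENNReal.ofReal (a ^ (-ε / 2 + u.re)) * (‖ψ (-a)‖₊ : ℝ≥0∞) ^ 2)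
            + coefSumFull p u b ε (-1) *
                (∫⁻ a in Ioi (0:ℝ),
                  ENNReal.ofReal (a ^ (-ε / 2 + u.re)) * (‖ψ a‖₊ : ℝ≥0∞) ^ 2)) := by
  have hψm := hψc.measurable
  refine ⟨fun a₁ ha₁ => ?_, ?_⟩
  · simp_rw [← enorm_eq_nnnorm]
    rw [lhsInt_eq_tsum_nat hp u hb0 hb hψc hψ ε measurableSet_Ioc fun _ h => h.1,
      lintegral_mul_coefSum hp u b ε 1 ha₁ (by fun_prop),
      lintegral_mul_coefSum hp u b ε (-1) ha₁ (by fun_prop)]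
    congr 3 <;> ext n <;> split_ifs with hn
    · rw [image_mul_zpow_Ioc (by positivity) ha₁, one_mul]
    · rfl
    · rw [image_mul_zpow_Ioc (by positivity) ha₁, neg_one_mul]
    · rfl
  · rw [lhsInt_eq_tsum_nat hp u hb0 hb hψc hψ ε measurableSet_Ioi subset_rfl, coefSumFull,
      coefSumFull, ← ENNReal.tsum_mul_right, ← ENNReal.tsum_mul_right]
    simp_rw [← enorm_eq_nnnorm]
    congr 3 <;> ext n <;> split_ifs with hn
    · rw [image_mul_zpow_Ioi (by positivity), one_mul]
    · simp
    · rw [image_mul_zpow_Ioi (by positivity), neg_one_mul]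
    · simp
end
end

section
/- Fix a positive integer p, u = u₀ + iu₁ ∈ ℂ with u₀ = Re(u) < 1, complex coefficients (b_m)_{m ∈ ℤ∖{0}} of at most polynomial growth, and a continuous rapidly decreasing ψ : ℝ → ℂ; define f_ψ(a,t) = a^{−1−u} Σ_{m ≠ 0} ψ(−(m/p) a^{−2}) b_m e^{−2πi t m/p}. Assume f_ψ is bounded on (0,∞) × ℝ and that there are μ > 0 and C > 0 with |f_ψ(a,t)|² ≤ C a^{μ} for all a > 0, t ∈ ℝ. Then for every ε ∈ (−μ, 0): if ψ(x) ≠ 0 for all x < 0, then Σ_{m ≥ 1} (m/p)^{ε/2 − 1 − u₀} |b_m|² < ∞; and if ψ(x) ≠ 0 for all x > 0, then Σ_{m ≥ 1} (m/p)^{ε/2 − 1 − u₀} |b_{−m}|² < ∞. -/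
open MeasureTheory Real Set
open scoped ENNReal NNReal

noncomputable section

/-- The Fourier coefficients of `f_ψ(a, ·)` are absolutely summable. -/
theorem summable_fW_coeff {p : ℕ} (hp : 0 < p) {b : ℤ → ℂ} (hb0 : b 0 = 0) (hb : PolyGrowth b)
    {ψ : ℝ → ℂ} (hψ : RapidDecay ψ) {a : ℝ} (ha : 0 < a) :
    Summable fun m : ℤ => ψ (-((m : ℝ) / (p : ℝ)) * a ^ (-2 : ℤ)) * b m := by
  obtain ⟨C, N, hbC⟩ := hb
  obtain ⟨j, hj⟩ := exists_nat_ge N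
  obtain ⟨D, hD⟩ := hψ (j + 2)
  have hp' : (0 : ℝ) < p := by exact_mod_cast hp
  set y : ℝ := a ^ (-2 : ℤ) / p with hy
  have hy0 : 0 < y := by positivity
  refine Summable.of_norm_bounded
    (g := fun m : ℤ => (D / y ^ (j + 2) * (|C| * 2 ^ j)) * (1 / (m : ℝ) ^ 2))
    ((Real.summable_one_div_int_pow.2 one_lt_two).mul_left _) fun m => ?_
  rcases eq_or_ne m 0 with rfl | hm
  · simp [hb0]
  have hm1 : (1 : ℝ) ≤ |(m : ℝ)| := by exact_mod_cast Int.one_le_abs hm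
  have hx : |(-((m : ℝ) / (p : ℝ)) * a ^ (-2 : ℤ))| = y * |(m : ℝ)| := by
    rw [abs_mul, abs_neg, abs_div, abs_of_pos hp', abs_of_pos (zpow_pos ha _), hy]
    ring
  have hψm : ‖ψ (-((m : ℝ) / (p : ℝ)) * a ^ (-2 : ℤ))‖ ≤ D / (y * |(m : ℝ)|) ^ (j + 2) := by
    rw [le_div_iff₀' (by positivity)]
    refine le_trans ?_ (hD (-((m : ℝ) / (p : ℝ)) * a ^ (-2 : ℤ)))
    rw [hx]
    gcongr
    linarith
  have hbm : ‖b m‖ ≤ |C| * (2 * |(m : ℝ)|) ^ j := by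
    calc ‖b m‖ ≤ C * (1 + |(m : ℝ)|) ^ N := hbC m
      _ ≤ |C| * (1 + |(m : ℝ)|) ^ (j : ℝ) := by
        gcongr
        · exact le_abs_self C
        · linarith
      _ ≤ |C| * (2 * |(m : ℝ)|) ^ j := by
        rw [Real.rpow_natCast]
        gcongr
        linarith
  calc ‖ψ (-((m : ℝ) / (p : ℝ)) * a ^ (-2 : ℤ)) * b m‖
      ≤ D / (y * |(m : ℝ)|) ^ (j + 2) * (|C| * (2 * |(m : ℝ)|) ^ j) := by
        rw [norm_mul]
        exact mul_le_mul hψm hbm (norm_nonneg _) ((norm_nonneg _).trans hψm)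
    _ = (D / y ^ (j + 2) * (|C| * 2 ^ j)) * (1 / (m : ℝ) ^ 2) := by
        rw [← sq_abs (m : ℝ), mul_pow, mul_pow]
        field_simp
        ring

/-- Bessel's inequality for an absolutely convergent Fourier series with bounded sum. -/
theorem sum_sq_norm_le_of_fourier_series_bounded {T : ℝ} [Fact (0 < T)] {c : ℤ → ℂ}
    (hc : Summable c) {B : ℝ}
    (hB : ∀ t : ℝ, ‖∑' m : ℤ, c m * fourier m (t : AddCircle T)‖ ≤ B) (F : Finset ℤ) :
    ∑ m ∈ F, ‖c m‖ ^ 2 ≤ B ^ 2 := by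
  have hs : Summable fun m : ℤ => c m • (fourier m : C(AddCircle T, ℂ)) :=
    Summable.of_norm (by simpa [norm_smul, fourier_norm] using hc.norm)
  obtain ⟨G, hG⟩ := hs
  have hB0 : 0 ≤ B := (norm_nonneg _).trans (hB 0)
  have hGB : ‖G‖ ≤ B := by
    refine (ContinuousMap.norm_le _ hB0).2 fun x => ?_
    induction x using QuotientAddGroup.induction_on with
    | H t =>
      have h1 := (ContinuousMap.hasSum_apply hG (t : AddCircle T)).tsum_eq
      simp only [ContinuousMap.smul_apply, smul_eq_mul] at h1
      have h2 := hB t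
      rw [h1] at h2
      exact h2
  let L := ContinuousMap.toLp (E := ℂ) 2 (AddCircle.haarAddCircle (T := T)) ℂ
  have hLG : HasSum (fun m : ℤ => c m • fourierLp (T := T) 2 m) (L G) := by
    have h := hG.mapL L
    simpa only [map_smul] using h
  have hin : ∀ n : ℤ, inner ℂ (fourierLp (T := T) 2 n) (L G) = c n := fun n => by
    have h := hLG.mapL (innerSL ℂ (fourierLp (T := T) 2 n))
    have ho := orthonormal_iff_ite.1 (orthonormal_fourier (T := T)) n
    simp only [map_smul, innerSL_apply_apply, ho, smul_eq_mul] at h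
    refine h.unique ?_
    convert hasSum_single n fun m hm => ?_ using 1
    · simp
    · simp [Ne.symm hm]
  have hL : ‖L G‖ ≤ B := by
    have h1 : ‖L‖ ≤ 1 := by
      have := ContinuousMap.toLp_norm_le (p := 2) (μ := AddCircle.haarAddCircle (T := T))
        (E := ℂ) (𝕜 := ℂ)
      simpa [L, measureUnivNNReal] using this
    calc ‖L G‖ ≤ ‖L‖ * ‖G‖ := L.le_opNorm G
      _ ≤ 1 * B := by gcongr
      _ = B := one_mul B
  have hbes := (orthonormal_fourier (T := T)).sum_inner_products_le (L G) (s := F)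
  simp only [hin] at hbes
  exact hbes.trans (by gcongr)

/-- A bound for `f_ψ` controls the square sums of its Fourier coefficients. -/
theorem sum_sq_fW_coeff_le {p : ℕ} (hp : 0 < p) {u : ℂ} {b : ℤ → ℂ} (hb0 : b 0 = 0)
    (hb : PolyGrowth b) {ψ : ℝ → ℂ} (hψ : RapidDecay ψ) {M : ℝ} {a : ℝ} (ha : 0 < a)
    (hbdd : ∀ t : ℝ, ‖fW p u b ψ a t‖ ≤ M) (F : Finset ℤ) :
    ∑ m ∈ F, (‖ψ (-((m : ℝ) / (p : ℝ)) * a ^ (-2 : ℤ))‖ * ‖b m‖) ^ 2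
      ≤ M ^ 2 * a ^ (2 + 2 * u.re) := by
  have hp' : (0 : ℝ) < p := by exact_mod_cast hp
  have : Fact ((0 : ℝ) < p) := ⟨hp'⟩
  have h := sum_sq_norm_le_of_fourier_series_bounded (T := p)
    (summable_fW_coeff hp hb0 hb hψ ha) (B := M * a ^ (1 + u.re)) (fun t => ?_) F
  · simp only [norm_mul] at h
    refine h.trans_eq ?_
    rw [mul_pow, ← Real.rpow_natCast (a ^ _), ← Real.rpow_mul ha.le]
    congr 2
    push_cast
    ring
  · have h := hbdd (-t)
    have hn : ‖(a : ℂ) ^ (-1 - u)‖ = (a ^ (1 + u.re))⁻¹ := by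
      rw [Complex.norm_cpow_eq_rpow_re_of_pos ha, ← Real.rpow_neg ha.le]
      congr 1
      simp
      ring
    rw [fW, norm_mul, hn, inv_mul_le_iff₀ (by positivity), mul_comm] at h
    rw [mul_comm]
    refine le_trans (le_of_eq ?_) h
    congr 1
    refine tsum_congr fun m => ?_
    rw [fourier_coe_apply]
    congr 2
    push_cast
    ring

/-- Dyadic summation: a uniform bound on the square sums of `φ (m a⁻² / q) d m`, with `φ`
positive, yields convergence of a weighted square sum of `d`. -/
theorem tsum_weighted_sq_lt_top {φ : ℝ → ℝ} (hφc : Continuous φ) (hφ : ∀ x, 0 < x → 0 < φ x)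
    {q : ℝ} (hq : 0 < q) {d : ℕ → ℂ} {B v ε : ℝ} (hε : ε < 0)
    (hB : ∀ a : ℝ, 0 < a → ∀ F : Finset ℕ,
      ∑ m ∈ F, (φ ((m : ℝ) / q * a ^ (-2 : ℤ)) * ‖d m‖) ^ 2 ≤ B * a ^ (2 + 2 * v)) :
    (∑' m : ℕ, if 1 ≤ m then
        ENNReal.ofReal (((m : ℝ) / q) ^ (ε / 2 - 1 - v)) * (‖d m‖₊ : ℝ≥0∞) ^ 2
      else 0) < ⊤ := by
  set s : ℝ := ε / 2 - 1 - v with hs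
  obtain ⟨x₀, hx₀, hmin⟩ := isCompact_Icc.exists_isMinOn (nonempty_Icc.2 (by norm_num : (1 : ℝ) ≤ 4))
    hφc.continuousOn
  set δ := φ x₀ with hδ
  have hδ0 : 0 < δ := hφ x₀ (by linarith [hx₀.1])
  have hB0 : 0 ≤ B := by simpa using hB 1 one_pos ∅
  set L : ℝ := 4 ^ |s|
  set K : ℝ := L * (δ ^ 2)⁻¹ * B * (√q)⁻¹ ^ ε with hK
  have hK0 : 0 ≤ K := by positivity
  have hblock : ∀ k : ℕ, ∑ m ∈ Finset.Ico (4 ^ k : ℕ) (4 ^ (k + 1)), ((m : ℝ) / q) ^ s * ‖d m‖ ^ 2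
      ≤ K * (2 ^ ε) ^ k := by
    intro k
    set a : ℝ := 2 ^ k * (√q)⁻¹ with ha
    have ha0 : 0 < a := by positivity
    have ha2 : a ^ 2 = 4 ^ k / q := by
      rw [ha, mul_pow, inv_pow, Real.sq_sqrt hq.le, ← pow_mul, mul_comm k 2, pow_mul]
      norm_num [div_eq_mul_inv]
    have hz : a ^ (-2 : ℤ) = (a ^ 2)⁻¹ := by
      rw [zpow_neg]; norm_cast
    have hterm : ∀ m ∈ Finset.Ico (4 ^ k : ℕ) (4 ^ (k + 1)), ((m : ℝ) / q) ^ s * ‖d m‖ ^ 2 ≤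
        (L * (a ^ 2) ^ s * (δ ^ 2)⁻¹) * (φ ((m : ℝ) / q * a ^ (-2 : ℤ)) * ‖d m‖) ^ 2 := by
      intro m hm
      rw [Finset.mem_Ico] at hm
      have h1 : (4 : ℝ) ^ k ≤ m := by exact_mod_cast hm.1
      have h2 : (m : ℝ) ≤ 4 ^ k * 4 := by rw [← pow_succ]; exact_mod_cast hm.2.le
      set x : ℝ := (m : ℝ) / q * a ^ (-2 : ℤ) with hx
      have hx' : x = m / 4 ^ k := by
        rw [hx, hz, ha2]
        field_simp
      have hx1 : 1 ≤ x := by rw [hx', le_div_iff₀ (by positivity)]; linarith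
      have hx4 : x ≤ 4 := by rw [hx', div_le_iff₀ (by positivity)]; linarith
      have hmx : (m : ℝ) / q = x * a ^ 2 := by
        rw [hx, hz]
        field_simp
      have hφx : δ ≤ φ x := hmin ⟨hx1, hx4⟩
      have hxs : x ^ s ≤ L :=
        (Real.rpow_le_rpow_of_exponent_le hx1 (le_abs_self s)).trans
          (Real.rpow_le_rpow (by linarith) hx4 (abs_nonneg s))
      have hone : 1 ≤ (δ ^ 2)⁻¹ * φ x ^ 2 := by
        rw [le_inv_mul_iff₀ (by positivity), mul_one]
        gcongr
      rw [hmx, Real.mul_rpow (by linarith) (by positivity)]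
      calc x ^ s * (a ^ 2) ^ s * ‖d m‖ ^ 2 ≤ L * (a ^ 2) ^ s * ‖d m‖ ^ 2 * 1 := by
            rw [mul_one]; gcongr
        _ ≤ L * (a ^ 2) ^ s * ‖d m‖ ^ 2 * ((δ ^ 2)⁻¹ * φ x ^ 2) := by gcongr
        _ = _ := by ring
    refine (Finset.sum_le_sum hterm).trans ?_
    rw [← Finset.mul_sum]
    refine (mul_le_mul_of_nonneg_left (hB a ha0 _) (by positivity)).trans_eq ?_
    have hpow : (a ^ 2) ^ s * a ^ (2 + 2 * v) = (√q)⁻¹ ^ ε * (2 ^ ε) ^ k := by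
      rw [← Real.rpow_natCast a 2, ← Real.rpow_mul ha0.le, ← Real.rpow_add ha0,
        show ((2 : ℕ) : ℝ) * s + (2 + 2 * v) = ε by push_cast; rw [hs]; ring, ha,
        Real.mul_rpow (by positivity) (by positivity), ← Real.rpow_natCast, ← Real.rpow_natCast,
        ← Real.rpow_mul (by norm_num), ← Real.rpow_mul (by norm_num), mul_comm (k : ℝ), mul_comm]
    calc _ = L * (δ ^ 2)⁻¹ * B * ((a ^ 2) ^ s * a ^ (2 + 2 * v)) := by ring
      _ = _ := by rw [hpow, hK]; ring
  have hgeom : Summable fun k : ℕ => K * ((2 : ℝ) ^ ε) ^ k :=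
    (summable_geometric_of_lt_one (by positivity)
      (Real.rpow_lt_one_of_one_lt_of_neg one_lt_two hε)).mul_left K
  set w : ℕ → ℝ≥0∞ := fun m =>
    ENNReal.ofReal (((m : ℝ) / q) ^ s) * (‖d m‖₊ : ℝ≥0∞) ^ 2
  have hw : ∀ m, w m = ENNReal.ofReal (((m : ℝ) / q) ^ s * ‖d m‖ ^ 2) := fun m => by
    rw [ENNReal.ofReal_mul (by positivity), ENNReal.ofReal_pow (norm_nonneg _),
      ofReal_norm]
    rfl
  calc (∑' m : ℕ, if 1 ≤ m then w m else 0)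
      ≤ ∑' m : ℕ, ∑' k : ℕ, if m ∈ Finset.Ico (4 ^ k) (4 ^ (k + 1)) then w m else 0 := by
        refine ENNReal.tsum_le_tsum fun m => ?_
        split_ifs with hm
        · refine le_trans ?_ (ENNReal.le_tsum (Nat.log 4 m))
          rw [if_pos (Finset.mem_Ico.2 ⟨Nat.pow_log_le_self 4 (by omega),
            Nat.lt_pow_succ_log_self (by norm_num) m⟩)]
        · exact zero_le
    _ = ∑' k : ℕ, ∑ m ∈ Finset.Ico (4 ^ k) (4 ^ (k + 1)), w m := by
        rw [ENNReal.tsum_comm]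
        refine tsum_congr fun k => ?_
        rw [tsum_eq_sum (s := Finset.Ico (4 ^ k) (4 ^ (k + 1))) fun m hm => if_neg hm]
        exact Finset.sum_congr rfl fun m hm => if_pos hm
    _ ≤ ∑' k : ℕ, ENNReal.ofReal (K * (2 ^ ε) ^ k) := by
        refine ENNReal.tsum_le_tsum fun k => ?_
        simp only [hw]
        rw [← ENNReal.ofReal_sum_of_nonneg fun m _ => by positivity]
        exact ENNReal.ofReal_le_ofReal (hblock k)
    _ < ⊤ := by
        rw [← ENNReal.ofReal_tsum_of_nonneg (fun k => by positivity) hgeom]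
        exact ENNReal.ofReal_lt_top

/-- if `f_ψ` is bounded and `|f_ψ(a,t)|² ≤ C a^μ` (rapid decay at the cusp),
then for each `ε ∈ (−μ, 0)` the coefficient sums `Σ_{m ≥ 1} (m/p)^{ε/2−1−u₀} |b_{±m}|²`
converge (according to which half-line `ψ` is nonvanishing on). -/
theorem stmt7 (p : ℕ) (hp : 0 < p) (u : ℂ) (hu : u.re < 1)
    (b : ℤ → ℂ) (hb0 : b 0 = 0) (hb : PolyGrowth b)
    (ψ : ℝ → ℂ) (hψc : Continuous ψ) (hψ : RapidDecay ψ)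
    (M : ℝ) (hbdd : ∀ a : ℝ, 0 < a → ∀ t : ℝ, ‖fW p u b ψ a t‖ ≤ M)
    (μ C : ℝ) (hμ : 0 < μ) (hC : 0 < C)
    (hdecay : ∀ a : ℝ, 0 < a → ∀ t : ℝ, ‖fW p u b ψ a t‖ ^ 2 ≤ C * a ^ μ) :
    ∀ ε : ℝ, -μ < ε → ε < 0 →
      ((∀ x : ℝ, x < 0 → ψ x ≠ 0) →
        (∑' m : ℕ, if 1 ≤ m then
            ENNReal.ofReal (((m : ℝ) / (p : ℝ)) ^ (ε / 2 - 1 - u.re)) *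
              (‖b (m : ℤ)‖₊ : ℝ≥0∞) ^ 2
          else 0) < ⊤) ∧
      ((∀ x : ℝ, 0 < x → ψ x ≠ 0) →
        (∑' m : ℕ, if 1 ≤ m then
            ENNReal.ofReal (((m : ℝ) / (p : ℝ)) ^ (ε / 2 - 1 - u.re)) *
              (‖b (-(m : ℤ))‖₊ : ℝ≥0∞) ^ 2
          else 0) < ⊤) := by
  intro ε _ hε
  have hp' : (0 : ℝ) < p := by exact_mod_cast hp
  have key := fun (a : ℝ) (ha : 0 < a) => sum_sq_fW_coeff_le hp hb0 hb hψ ha (hbdd a ha)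
  constructor
  · intro h0
    refine tsum_weighted_sq_lt_top (φ := fun x => ‖ψ (-x)‖) (d := fun m : ℕ => b m)
      (B := M ^ 2) (by fun_prop) (fun x hx => norm_pos_iff.2 (h0 _ (neg_lt_zero.2 hx))) hp' hε
      fun a ha F => ?_
    simpa [neg_mul] using key a ha (F.map Nat.castEmbedding)
  · intro h0
    refine tsum_weighted_sq_lt_top (φ := fun x => ‖ψ x‖) (d := fun m : ℕ => b (-(m : ℤ)))
      (B := M ^ 2) (by fun_prop) (fun x hx => norm_pos_iff.2 (h0 _ hx)) hp' hε
      fun a ha F => ?_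
    simpa [neg_div] using
      key a ha (F.map (Nat.castEmbedding.trans (Equiv.neg ℤ).toEmbedding))
end
end

section
/- Fix a positive integer p, u = u₀ + iu₁ ∈ ℂ with u₀ = Re(u) < 1, complex coefficients (b_m)_{m ∈ ℤ∖{0}} of at most polynomial growth, and a continuous rapidly decreasing ψ : ℝ → ℂ with ψ(x) ≠ 0 for all x < 0; define f_ψ(a,t) = a^{−1−u} Σ_{m ≠ 0} ψ(−(m/p) a^{−2}) b_m e^{−2πi t m/p}. Assume f_ψ is bounded on (0,∞) × ℝ. Then for every ε > 0 there exists C_ε > 0 such that for every real k > 1: Σ_{1 ≤ m ≤ pk} (m/p)^{ε/2 − 1 − u₀} |b_m|² ≤ C_ε k^{ε/2}. (If instead ψ(x) ≠ 0 for all x > 0, the same bound holds with b_{−m} in place of b_m.) -/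
open MeasureTheory Real Set
open scoped ENNReal NNReal

noncomputable section

/-- Bessel's inequality for an absolutely convergent Fourier series bounded by `R`. -/
theorem sum_sq_le_of_norm_tsum_exp_le {T : ℝ} (hT : 0 < T) {c : ℤ → ℂ}
    (hc : Summable fun m => ‖c m‖) {R : ℝ}
    (h : ∀ t : ℝ, ‖∑' m : ℤ, c m *
      Complex.exp (-2 * (π : ℂ) * Complex.I * (t : ℂ) * (m : ℂ) / (T : ℂ))‖ ≤ R)
    (s : Finset ℤ) : ∑ m ∈ s, ‖c m‖ ^ 2 ≤ R ^ 2 := by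
  have : Fact (0 < T) := ⟨hT⟩
  have hR : 0 ≤ R := (norm_nonneg _).trans (h 0)
  have hsum : Summable fun m : ℤ => c m • (fourier (-m) : C(AddCircle T, ℂ)) := by
    refine Summable.of_norm (hc.congr fun m => ?_)
    rw [norm_smul, fourier_norm, mul_one]
  obtain ⟨g, hg⟩ := hsum
  have hgR : ‖g‖ ≤ R := by
    refine (ContinuousMap.norm_le _ hR).2 fun x => ?_
    induction x using QuotientAddGroup.induction_on with
    | H t =>
      have hev := (ContinuousMap.hasSum_apply hg (t : AddCircle T)).tsum_eq
      refine le_of_eq_of_le ?_ (h t)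
      rw [← hev]
      congr 1
      refine tsum_congr fun m => ?_
      simp only [ContinuousMap.coe_smul, Pi.smul_apply, smul_eq_mul]
      erw [fourier_coe_apply]
      congr 2
      push_cast
      ring
  let L := ContinuousMap.toLp (E := ℂ) 2 (AddCircle.haarAddCircle (T := T)) ℂ
  have hLg : ‖L g‖ ≤ R := by
    refine (L.le_opNorm g).trans ?_
    have hL : ‖L‖ ≤ 1 := by
      refine (ContinuousMap.toLp_norm_le (μ := AddCircle.haarAddCircle (T := T))
        (E := ℂ) (p := 2) (𝕜 := ℂ)).trans_eq ?_
      have huniv : measureUnivNNReal (AddCircle.haarAddCircle (T := T)) = 1 := by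
        simp [measureUnivNNReal]
      simp [huniv]
    calc ‖L‖ * ‖g‖ ≤ 1 * R := by gcongr
      _ = R := one_mul R
  have hinner (i : ℤ) : inner ℂ (fourierLp (T := T) 2 (-i)) (L g) = c i := by
    have h1 := (hg.mapL L).mapL (innerSL ℂ (fourierLp (T := T) 2 (-i)))
    refine HasSum.unique h1 (Eq.subst (motive := fun f => HasSum f (c i)) (funext fun m => ?_)
      (hasSum_ite_eq i (c i)))
    symm
    have h2 : L (fourier (-m)) = fourierLp (T := T) 2 (-m) := rfl
    rw [map_smul, map_smul, h2, innerSL_apply_apply,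
      orthonormal_iff_ite.1 orthonormal_fourier]
    by_cases hmi : m = i
    · simp [hmi]
    · simp [hmi, Ne.symm hmi]
  have hbessel := (orthonormal_fourier (T := T)).sum_inner_products_le (L g)
    (s := s.map (Equiv.neg ℤ).toEmbedding)
  rw [Finset.sum_map] at hbessel
  simp only [Equiv.coe_toEmbedding, Equiv.neg_apply, hinner] at hbessel
  exact hbessel.trans (by gcongr)

/-- The coefficients of the Fourier–Whittaker series are absolutely summable. -/
theorem summable_norm_whittaker {b : ℤ → ℂ} (hb0 : b 0 = 0) (hb : PolyGrowth b) {ψ : ℝ → ℂ}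
    (hψ : RapidDecay ψ) {r : ℝ} (hr : 0 < r) :
    Summable fun m : ℤ => ‖ψ (-(m : ℝ) * r) * b m‖ := by
  obtain ⟨C, N, hC⟩ := hb
  obtain ⟨D, hD⟩ := hψ (⌈N⌉₊ + 2)
  have hD0 : 0 ≤ D := le_trans (by positivity) (hD 0)
  set q := min 1 r with hq
  have hq0 : 0 < q := lt_min one_pos hr
  refine Summable.of_nonneg_of_le (fun _ => norm_nonneg _) (fun m => ?_)
    ((Real.summable_one_div_int_pow.2 one_lt_two).mul_left (D * |C| / q ^ (⌈N⌉₊ + 2)))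
  rcases eq_or_ne m 0 with rfl | hm
  · simp [hb0]
  have hm0 : 0 < |(m : ℝ)| := by positivity
  set w : ℝ := 1 + |(m : ℝ)| with hw
  have hw1 : 1 ≤ w := by linarith
  have hw0 : 0 < w := by linarith
  have hb' : ‖b m‖ ≤ |C| * w ^ ⌈N⌉₊ := by
    refine (hC m).trans ?_
    have h1 : w ^ N ≤ w ^ ⌈N⌉₊ := by
      rw [← Real.rpow_natCast]
      exact Real.rpow_le_rpow_of_exponent_le hw1 (Nat.le_ceil N)
    exact mul_le_mul (le_abs_self C) h1 (by positivity) (abs_nonneg C)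
  have hψ' : (q * w) ^ (⌈N⌉₊ + 2) * ‖ψ (-(m : ℝ) * r)‖ ≤ D := by
    refine le_trans ?_ (hD (-(m : ℝ) * r))
    gcongr
    rw [abs_mul, abs_neg, abs_of_pos hr, hw, mul_add, mul_one, mul_comm q]
    gcongr
    · exact min_le_left _ _
    · exact min_le_right _ _
  have hψ'' : ‖ψ (-(m : ℝ) * r)‖ ≤ D / (q * w) ^ (⌈N⌉₊ + 2) := by
    rw [le_div_iff₀ (by positivity)]
    linarith
  calc ‖ψ (-(m : ℝ) * r) * b m‖ = ‖ψ (-(m : ℝ) * r)‖ * ‖b m‖ := norm_mul _ _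
    _ ≤ D / (q * w) ^ (⌈N⌉₊ + 2) * (|C| * w ^ ⌈N⌉₊) := by gcongr
    _ = D * |C| / q ^ (⌈N⌉₊ + 2) * (1 / w ^ 2) := by
      rw [mul_pow, pow_add w]
      field_simp
    _ ≤ D * |C| / q ^ (⌈N⌉₊ + 2) * (1 / (m : ℝ) ^ 2) := by
      rw [← sq_abs (m : ℝ)]
      gcongr
      linarith

/-- Bessel's inequality for a bounded Fourier–Whittaker series at height `a = √x`. -/
theorem sum_whittaker_sq_le {p : ℕ} (hp : 0 < p) {u : ℂ} {b : ℤ → ℂ} (hb0 : b 0 = 0)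
    (hb : PolyGrowth b) {ψ : ℝ → ℂ} (hψ : RapidDecay ψ) {M : ℝ}
    (hbdd : ∀ a : ℝ, 0 < a → ∀ t : ℝ, ‖fW p u b ψ a t‖ ≤ M) {x : ℝ} (hx : 0 < x)
    (s : Finset ℤ) :
    ∑ m ∈ s, ‖ψ (-((m : ℝ) / (p * x))) * b m‖ ^ 2 ≤ M ^ 2 * x ^ (1 + u.re) := by
  have hp' : (0 : ℝ) < p := by exact_mod_cast hp
  have ha : 0 < √x := Real.sqrt_pos.2 hx
  have harg (m : ℤ) : -((m : ℝ) / (p : ℝ)) * √x ^ (-2 : ℤ) = -((m : ℝ) / (p * x)) := by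
    rw [zpow_neg, zpow_ofNat, Real.sq_sqrt hx.le]
    field_simp
  have hsum := summable_norm_whittaker hb0 hb hψ (r := ((p : ℝ) * x)⁻¹) (by positivity)
  simp only [← div_eq_mul_inv, neg_div] at hsum
  have hpow : (M * √x ^ (1 + u.re)) ^ 2 = M ^ 2 * x ^ (1 + u.re) := by
    rw [mul_pow, ← Real.rpow_natCast (√x ^ (1 + u.re)), ← Real.rpow_mul ha.le, mul_comm (1 + u.re),
      Real.rpow_mul ha.le, Real.rpow_natCast, Real.sq_sqrt hx.le]
  rw [← hpow]
  refine sum_sq_le_of_norm_tsum_exp_le hp' hsum (fun t => ?_) s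
  have h1 := hbdd _ ha t
  simp only [fW, harg] at h1
  rw [norm_mul, Complex.norm_cpow_eq_rpow_re_of_pos ha] at h1
  have h2 : (-1 - u).re = -(1 + u.re) := by simp; ring
  rw [h2, Real.rpow_neg ha.le, inv_mul_le_iff₀ (by positivity), mul_comm _ M] at h1
  exact_mod_cast h1

/-- If the dyadic blocks `x/2 < m/p ≤ x` of a sum contribute at most `A x ^ δ`, then the
full sum over `m/p ≤ x` is at most `A / (1 - 2 ^ (-δ)) * x ^ δ`. -/
theorem sum_Icc_floor_le_of_dyadic {p : ℕ} {g : ℕ → ℝ} {A δ : ℝ} (hA : 0 ≤ A) (hδ : 0 < δ)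
    (h : ∀ x : ℝ, 0 < x → ∀ s : Finset ℕ,
      (∀ m ∈ s, p * (x / 2) < m ∧ (m : ℝ) ≤ p * x) → ∑ m ∈ s, g m ≤ A * x ^ δ)
    {x : ℝ} (hx : 0 < x) :
    ∑ m ∈ Finset.Icc 1 ⌊p * x⌋₊, g m ≤ A / (1 - 2 ^ (-δ)) * x ^ δ := by
  have h2 : (2 : ℝ) ^ (-δ) < 1 := Real.rpow_lt_one_of_one_lt_of_neg one_lt_two (by linarith)
  have h2' : 0 < 1 - (2 : ℝ) ^ (-δ) := by linarith
  obtain ⟨n, hn⟩ := pow_unbounded_of_one_lt (p * x) one_lt_two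
  induction n generalizing x with
  | zero =>
    rw [pow_zero] at hn
    rw [Nat.floor_eq_zero.2 hn]
    simp only [Finset.Icc_eq_empty_of_lt zero_lt_one, Finset.sum_empty]
    positivity
  | succ n ih =>
    have hhalf := ih (x := x / 2) (by positivity) (by rw [pow_succ] at hn; linarith)
    have hblock := h x hx ((Finset.Icc 1 ⌊p * x⌋₊).filter fun m => ¬ (m : ℝ) ≤ p * (x / 2))
      fun m hm => by
        simp only [Finset.mem_filter, Finset.mem_Icc, not_le] at hm
        exact ⟨hm.2, (Nat.le_floor_iff (by positivity)).1 hm.1.2⟩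
    have hfilter : (Finset.Icc 1 ⌊p * x⌋₊).filter (fun m : ℕ => (m : ℝ) ≤ p * (x / 2)) =
        Finset.Icc 1 ⌊p * (x / 2)⌋₊ := by
      ext m
      have hpx : (0 : ℝ) ≤ p * x := by positivity
      simp only [Finset.mem_filter, Finset.mem_Icc, Nat.le_floor_iff hpx,
        Nat.le_floor_iff (show (0 : ℝ) ≤ p * (x / 2) by positivity)]
      exact ⟨fun hm => ⟨hm.1.1, hm.2⟩, fun hm => ⟨⟨hm.1, by linarith [hm.2]⟩, hm.2⟩⟩
    rw [← Finset.sum_filter_add_sum_filter_not _ fun m : ℕ => (m : ℝ) ≤ p * (x / 2), hfilter]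
    refine (add_le_add hhalf hblock).trans_eq ?_
    rw [Real.div_rpow hx.le zero_le_two, div_eq_mul_inv (x ^ δ), ← Real.rpow_neg zero_le_two]
    field_simp
    ring

/-- if `f_ψ` is bounded and `ψ` is nonvanishing on the negative half-line,
then for every `ε > 0` there is `C_ε > 0` with
`Σ_{1 ≤ m ≤ pk} (m/p)^{ε/2−1−u₀} |b_m|² ≤ C_ε k^{ε/2}` for all real `k > 1`. -/
theorem stmt8 (p : ℕ) (hp : 0 < p) (u : ℂ) (hu : u.re < 1)
    (b : ℤ → ℂ) (hb0 : b 0 = 0) (hb : PolyGrowth b)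
    (ψ : ℝ → ℂ) (hψc : Continuous ψ) (hψ : RapidDecay ψ)
    (hψneg : ∀ x : ℝ, x < 0 → ψ x ≠ 0)
    (M : ℝ) (hbdd : ∀ a : ℝ, 0 < a → ∀ t : ℝ, ‖fW p u b ψ a t‖ ≤ M) :
    ∀ ε : ℝ, 0 < ε → ∃ Cε : ℝ, 0 < Cε ∧
      ∀ k : ℝ, 1 < k →
        (∑' m : ℕ, if 1 ≤ m ∧ (m : ℝ) ≤ (p : ℝ) * k then
            ENNReal.ofReal (((m : ℝ) / (p : ℝ)) ^ (ε / 2 - 1 - u.re)) *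
              (‖b (m : ℤ)‖₊ : ℝ≥0∞) ^ 2
          else 0)
          ≤ ENNReal.ofReal (Cε * k ^ (ε / 2)) := by
  intro ε hε
  have hp' : (0 : ℝ) < p := by exact_mod_cast hp
  obtain ⟨c, hc0, hc⟩ : ∃ c > 0, ∀ y ∈ Icc (-1 : ℝ) (-(1 / 2)), c ≤ ‖ψ y‖ := by
    obtain ⟨y₀, hy₀, hmin⟩ := isCompact_Icc.exists_isMinOn
      (nonempty_Icc.2 (by norm_num : (-1 : ℝ) ≤ -(1 / 2))) hψc.norm.continuousOn
    exact ⟨‖ψ y₀‖, norm_pos_iff.2 (hψneg y₀ (by linarith [hy₀.2])), fun y hy => hmin hy⟩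
  set σ := ε / 2 - 1 - u.re with hσ
  set K : ℝ := 1 + (1 / 2) ^ σ with hK
  have hK0 : 0 < K := by positivity
  have hKle {v : ℝ} (hv : 1 / 2 < v) (hv1 : v ≤ 1) : v ^ σ ≤ K := by
    rcases le_total 0 σ with h | h
    · have h1 := Real.rpow_le_one (by linarith) hv1 h
      have h2 : (0 : ℝ) ≤ (1 / 2) ^ σ := by positivity
      linarith
    · have h1 := Real.rpow_le_rpow_of_nonpos (by norm_num) hv.le h
      linarith
  set A : ℝ := K * M ^ 2 / c ^ 2 with hA
  have hA0 : 0 ≤ A := by positivity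
  have hblock : ∀ x : ℝ, 0 < x → ∀ s : Finset ℕ,
      (∀ m ∈ s, p * (x / 2) < m ∧ (m : ℝ) ≤ p * x) →
        ∑ m ∈ s, ((m : ℝ) / p) ^ σ * ‖b (m : ℤ)‖ ^ 2 ≤ A * x ^ (ε / 2) := by
    intro x hx s hs
    have hbessel := sum_whittaker_sq_le hp hb0 hb hψ hbdd hx (s.map Nat.castEmbedding)
    rw [Finset.sum_map] at hbessel
    simp only [Nat.castEmbedding_apply, Int.cast_natCast] at hbessel
    have hterm : ∀ m ∈ s, ((m : ℝ) / p) ^ σ * ‖b (m : ℤ)‖ ^ 2 ≤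
        K * x ^ σ / c ^ 2 * ‖ψ (-((m : ℝ) / (p * x))) * b m‖ ^ 2 := by
      intro m hm
      obtain ⟨hm1, hm2⟩ := hs m hm
      have hv1 : 1 / 2 < (m : ℝ) / (p * x) := by
        rw [lt_div_iff₀ (by positivity)]
        linarith
      have hv2 : (m : ℝ) / (p * x) ≤ 1 := by
        rw [div_le_one (by positivity)]
        exact hm2
      have hψm := hc (-((m : ℝ) / (p * x))) ⟨by linarith, by linarith⟩
      have hpow : ((m : ℝ) / p) ^ σ ≤ K * x ^ σ := by
        rw [show (m : ℝ) / p = m / (p * x) * x by field_simp,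
          Real.mul_rpow (by positivity) hx.le]
        gcongr
        exact hKle hv1 hv2
      rw [norm_mul, mul_pow]
      calc ((m : ℝ) / p) ^ σ * ‖b (m : ℤ)‖ ^ 2 ≤ K * x ^ σ * ‖b (m : ℤ)‖ ^ 2 := by gcongr
        _ = K * x ^ σ / c ^ 2 * (c ^ 2 * ‖b (m : ℤ)‖ ^ 2) := by field_simp
        _ ≤ _ := by gcongr
    calc ∑ m ∈ s, ((m : ℝ) / p) ^ σ * ‖b (m : ℤ)‖ ^ 2
        ≤ K * x ^ σ / c ^ 2 * ∑ m ∈ s, ‖ψ (-((m : ℝ) / (p * x))) * b m‖ ^ 2 := by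
          rw [Finset.mul_sum]
          exact Finset.sum_le_sum hterm
      _ ≤ K * x ^ σ / c ^ 2 * (M ^ 2 * x ^ (1 + u.re)) := by gcongr
      _ = A * (x ^ σ * x ^ (1 + u.re)) := by rw [hA]; ring
      _ = A * x ^ (ε / 2) := by rw [← Real.rpow_add hx, hσ]; ring_nf
  have h2 : (2 : ℝ) ^ (-(ε / 2)) < 1 :=
    Real.rpow_lt_one_of_one_lt_of_neg one_lt_two (by linarith)
  have h2' : 0 < 1 - (2 : ℝ) ^ (-(ε / 2)) := by linarith
  refine ⟨A / (1 - 2 ^ (-(ε / 2))) + 1, by positivity, fun k hk => ?_⟩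
  have hk0 : 0 < k := by linarith
  have hmem (m : ℕ) : m ∈ Finset.Icc 1 ⌊p * k⌋₊ ↔ 1 ≤ m ∧ (m : ℝ) ≤ p * k := by
    rw [Finset.mem_Icc, Nat.le_floor_iff (by positivity)]
  rw [tsum_eq_sum (s := Finset.Icc 1 ⌊p * k⌋₊) fun m hm => if_neg fun h => hm ((hmem m).2 h)]
  calc _ = ∑ m ∈ Finset.Icc 1 ⌊p * k⌋₊,
        ENNReal.ofReal (((m : ℝ) / p) ^ σ * ‖b (m : ℤ)‖ ^ 2) := by
        refine Finset.sum_congr rfl fun m hm => ?_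
        rw [if_pos ((hmem m).1 hm), ENNReal.ofReal_mul (by positivity),
          ENNReal.ofReal_pow (norm_nonneg _), ofReal_norm]
        rfl
    _ = ENNReal.ofReal (∑ m ∈ Finset.Icc 1 ⌊p * k⌋₊,
        ((m : ℝ) / p) ^ σ * ‖b (m : ℤ)‖ ^ 2) :=
        (ENNReal.ofReal_sum_of_nonneg fun m _ => by positivity).symm
    _ ≤ _ := by
        refine ENNReal.ofReal_le_ofReal ?_
        refine (sum_Icc_floor_le_of_dyadic hA0 (by positivity) hblock hk0).trans ?_
        gcongr
        linarith
end
end
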